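/- arXiv:1311.0846 — 10 statements merged into one kernel-verified Lean document; each statement's English description precedes it below -/
import Mathlib

section
/- Let W be an algebraic Weyl tensor on ℝ⁴. Then for all indices i, j one has ∑_{k,p,q} W_{ikpq} W_{jkpq} = |W|² δ_{ij}. -/
/-- Let `W` be an algebraic Weyl tensor on `ℝ⁴` (curvature symmetries,
first Bianchi identity, total trace-freeness).  Then for all indices `i, j` one has
`∑_{k,p,q} W_{ikpq} W_{jkpq} = |W|² δ_{ij}`, where `|W|² = ∑_{i<j, k<l} (W_{ijkl})²`. -/
theorem weyl_contraction_eq_normSq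
    (W : Fin 4 → Fin 4 → Fin 4 → Fin 4 → ℝ)
    (hsym1 : ∀ i j k l, W i j k l = -W j i k l)
    (hsym2 : ∀ i j k l, W i j k l = -W i j l k)
    (hsym3 : ∀ i j k l, W i j k l = W k l i j)
    (hbianchi : ∀ i j k l, W i j k l + W i k l j + W i l j k = 0)
    (htrace : ∀ i j, ∑ k, W k i k j = 0) :
    ∀ i j : Fin 4,
      (∑ k, ∑ p, ∑ q, W i k p q * W j k p q) =
        (∑ a, ∑ b, ∑ c, ∑ d, if a < b ∧ c < d then (W a b c d) ^ 2 else 0) *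
          (if i = j then (1 : ℝ) else 0) := by
  have diag₁ (i k l) : W i i k l = 0 := by linarith [hsym1 i i k l]
  have diag₂ (i j k) : W i j k k = 0 := by linarith [hsym2 i j k k]
  have swap₁ (k l) : W 1 0 k l = -W 0 1 k l ∧ W 2 0 k l = -W 0 2 k l ∧ W 3 0 k l = -W 0 3 k l ∧
      W 2 1 k l = -W 1 2 k l ∧ W 3 1 k l = -W 1 3 k l ∧ W 3 2 k l = -W 2 3 k l :=
    ⟨hsym1 _ _ _ _, hsym1 _ _ _ _, hsym1 _ _ _ _, hsym1 _ _ _ _, hsym1 _ _ _ _, hsym1 _ _ _ _⟩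
  have swap₂ (i j) : W i j 1 0 = -W i j 0 1 ∧ W i j 2 0 = -W i j 0 2 ∧ W i j 3 0 = -W i j 0 3 ∧
      W i j 2 1 = -W i j 1 2 ∧ W i j 3 1 = -W i j 1 3 ∧ W i j 3 2 = -W i j 2 3 :=
    ⟨hsym2 _ _ _ _, hsym2 _ _ _ _, hsym2 _ _ _ _, hsym2 _ _ _ _, hsym2 _ _ _ _, hsym2 _ _ _ _⟩
  -- The trace and Bianchi identities leave ten independent components.
  have traces := And.intro (htrace 0 0) <| And.intro (htrace 0 1) <| And.intro (htrace 0 2) <|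
    And.intro (htrace 0 3) <| And.intro (htrace 1 1) <| And.intro (htrace 1 2) <|
    And.intro (htrace 1 3) <| And.intro (htrace 2 2) <| And.intro (htrace 2 3) (htrace 3 3)
  have bianchi := hbianchi 0 1 2 3
  simp only [Fin.sum_univ_four, diag₁, diag₂, swap₁, swap₂] at traces bianchi
  obtain ⟨t00, t01, t02, t03, t11, t12, t13, t22, t23, t33⟩ := traces
  have e2323 : W 2 3 2 3 = W 0 1 0 1 := by linarith
  have e1313 : W 1 3 1 3 = W 0 2 0 2 := by linarith
  have e1212 : W 1 2 1 2 = -W 0 1 0 1 - W 0 2 0 2 := by linarith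
  have e0303 : W 0 3 0 3 = -W 0 1 0 1 - W 0 2 0 2 := by linarith
  have e0313 : W 0 3 1 3 = -W 0 2 1 2 := by linarith
  have e0323 : W 0 3 2 3 = W 0 1 1 2 := by linarith
  have e1323 : W 1 3 2 3 = -W 0 1 0 2 := by linarith
  have e0223 : W 0 2 2 3 = -W 0 1 1 3 := by linarith
  have e1223 : W 1 2 2 3 = W 0 1 0 3 := by linarith
  have e1213 : W 1 2 1 3 = -W 0 2 0 3 := by linarith
  have e0312 : W 0 3 1 2 = W 0 2 1 3 - W 0 1 2 3 := by linarith
  intro i j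
  fin_cases i <;> fin_cases j <;>
    simp [Fin.sum_univ_four, diag₁, diag₂, swap₁, swap₂, hsym3 0 2 0 1, hsym3 0 3 0 1,
      hsym3 0 3 0 2, hsym3 1 2 0 1, hsym3 1 2 0 2, hsym3 1 2 0 3, hsym3 1 3 0 1, hsym3 1 3 0 2,
      hsym3 1 3 0 3, hsym3 1 3 1 2, hsym3 2 3 0 1, hsym3 2 3 0 2, hsym3 2 3 0 3, hsym3 2 3 1 2,
      hsym3 2 3 1 3, e2323, e1313, e1212, e0303, e0313, e0323, e1323, e0223, e1223, e1213,
      e0312] <;>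
    ring
end

section
/- Let W be an algebraic Weyl tensor on ℝ⁴. Then for all indices i, j one has ∑_{k,p,q} W_{ikpq} W_{kpqj} = (1/2) |W|² δ_{ij}. -/
/-- Let `W` be an algebraic Weyl tensor on `ℝ⁴`.  Then for all indices
`i, j` one has `∑_{k,p,q} W_{ikpq} W_{kpqj} = (1/2) |W|² δ_{ij}`, where
`|W|² = ∑_{i<j, k<l} (W_{ijkl})²`. -/
theorem weyl_contraction_cyclic_eq_half_normSq
    (W : Fin 4 → Fin 4 → Fin 4 → Fin 4 → ℝ)
    (hsym1 : ∀ i j k l, W i j k l = -W j i k l)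
    (hsym2 : ∀ i j k l, W i j k l = -W i j l k)
    (hsym3 : ∀ i j k l, W i j k l = W k l i j)
    (hbianchi : ∀ i j k l, W i j k l + W i k l j + W i l j k = 0)
    (htrace : ∀ i j, ∑ k, W k i k j = 0) :
    ∀ i j : Fin 4,
      (∑ k, ∑ p, ∑ q, W i k p q * W k p q j) =
        (1 / 2) * (∑ a, ∑ b, ∑ c, ∑ d, if a < b ∧ c < d then (W a b c d) ^ 2 else 0) *
          (if i = j then (1 : ℝ) else 0) := by
  have diag1 : ∀ i k l, W i i k l = 0 := fun i k l => by linarith [hsym1 i i k l]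
  have diag2 : ∀ i j k, W i j k k = 0 := fun i j k => by linarith [hsym2 i j k k]
  -- Rewrite rules ordering the indices inside each pair.
  have l10 := hsym1 1 0
  have l20 := hsym1 2 0
  have l30 := hsym1 3 0
  have l21 := hsym1 2 1
  have l31 := hsym1 3 1
  have l32 := hsym1 3 2
  have r10 := fun i j => hsym2 i j 1 0
  have r20 := fun i j => hsym2 i j 2 0
  have r30 := fun i j => hsym2 i j 3 0
  have r21 := fun i j => hsym2 i j 2 1
  have r31 := fun i j => hsym2 i j 3 1
  have r32 := fun i j => hsym2 i j 3 2
  -- Trace-freeness, the Bianchi identity and pair symmetry in ordered components.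
  have t00 := htrace 0 0
  have t11 := htrace 1 1
  have t22 := htrace 2 2
  have t33 := htrace 3 3
  have t01 := htrace 0 1
  have t02 := htrace 0 2
  have t03 := htrace 0 3
  have t12 := htrace 1 2
  have t13 := htrace 1 3
  have t23 := htrace 2 3
  have bianchi := hbianchi 0 1 2 3
  simp only [Fin.sum_univ_four, diag1, diag2, l10, l20, l30, l21, l31, l32,
    r10, r20, r30, r21, r31, r32, neg_neg, zero_add, add_zero]
    at t00 t11 t22 t33 t01 t02 t03 t12 t13 t23 bianchi
  have s1 := hsym3 0 2 0 1
  have s2 := hsym3 0 3 0 1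
  have s3 := hsym3 1 2 0 1
  have s4 := hsym3 1 3 0 1
  have s5 := hsym3 2 3 0 1
  have s6 := hsym3 0 3 0 2
  have s7 := hsym3 1 2 0 2
  have s8 := hsym3 1 3 0 2
  have s9 := hsym3 2 3 0 2
  have s10 := hsym3 1 2 0 3
  have s11 := hsym3 1 3 0 3
  have s12 := hsym3 2 3 0 3
  have s13 := hsym3 1 3 1 2
  have s14 := hsym3 2 3 1 2
  have s15 := hsym3 2 3 1 3
  -- Solve the linear relations in terms of ten independent components.
  have e1 : W 0 3 0 3 = -W 0 1 0 1 - W 0 2 0 2 := by linarith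
  have e2 : W 1 2 1 2 = -W 0 1 0 1 - W 0 2 0 2 := by linarith
  have e3 : W 1 3 1 3 = W 0 2 0 2 := by linarith
  have e4 : W 2 3 2 3 = W 0 1 0 1 := by linarith
  have e5 : W 0 3 1 3 = -W 0 2 1 2 := by linarith
  have e6 : W 0 3 2 3 = W 0 1 1 2 := by linarith
  have e7 : W 0 2 2 3 = -W 0 1 1 3 := by linarith
  have e8 : W 1 3 2 3 = -W 0 1 0 2 := by linarith
  have e9 : W 1 2 2 3 = W 0 1 0 3 := by linarith
  have e10 : W 1 2 1 3 = -W 0 2 0 3 := by linarith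
  have e11 : W 0 3 1 2 = W 0 2 1 3 - W 0 1 2 3 := by linarith
  have normSq : (∑ a, ∑ b, ∑ c, ∑ d, if a < b ∧ c < d then (W a b c d) ^ 2 else 0) =
      2 * (W 0 1 0 1 ^ 2 + W 0 2 0 2 ^ 2 + (W 0 1 0 1 + W 0 2 0 2) ^ 2
        + W 0 1 2 3 ^ 2 + W 0 2 1 3 ^ 2 + (W 0 2 1 3 - W 0 1 2 3) ^ 2)
      + 4 * (W 0 1 0 2 ^ 2 + W 0 1 0 3 ^ 2 + W 0 1 1 2 ^ 2 + W 0 1 1 3 ^ 2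
        + W 0 2 0 3 ^ 2 + W 0 2 1 2 ^ 2) := by
    simp [Fin.sum_univ_four, s1, s2, s3, s4, s5, s6, s7, s8, s9, s10, s11, s12, s13, s14, s15,
      e1, e2, e3, e4, e5, e6, e7, e8, e9, e10, e11]
    ring
  intro i j
  rw [normSq]
  fin_cases i <;> fin_cases j <;>
  · simp [Fin.sum_univ_four, diag1, diag2, l10, l20, l30, l21, l31, l32,
      r10, r20, r30, r21, r31, r32,
      s1, s2, s3, s4, s5, s6, s7, s8, s9, s10, s11, s12, s13, s14, s15,
      e1, e2, e3, e4, e5, e6, e7, e8, e9, e10, e11]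
    try ring
end

section
/- Let W be an algebraic Weyl tensor on ℝ⁴ and let v ∈ ℝ⁴ satisfy ∑_p v_p W_{pjkl} = 0 for all indices j, k, l. Then v = 0 or W = 0. -/
theorem sum_fin_four_eq_of_ne {M : Type*} [AddCommMonoid M] (f : Fin 4 → M) {a b c d : Fin 4}
    (hab : a ≠ b) (hac : a ≠ c) (had : a ≠ d) (hbc : b ≠ c) (hbd : b ≠ d) (hcd : c ≠ d) :
    ∑ p, f p = f a + f b + f c + f d := by
  have huniv : (Finset.univ : Finset (Fin 4)) = {a, b, c, d} := by
    revert a b c d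
    decide
  rw [huniv, Finset.sum_insert (by simp [*]), Finset.sum_insert (by simp [*]),
    Finset.sum_insert (by simp [*]), Finset.sum_singleton]
  simp only [add_assoc]

/-- If a nonzero vector annihilates an algebraic Weyl tensor, then the tensor has vanishing
components of the types `abab`, `abac` and `abcd` for pairwise distinct `a, b, c, d`. -/
theorem weyl_components_eq_zero
    (W : Fin 4 → Fin 4 → Fin 4 → Fin 4 → ℝ)
    (hsym1 : ∀ i j k l, W i j k l = -W j i k l)
    (hsym2 : ∀ i j k l, W i j k l = -W i j l k)
    (hsym3 : ∀ i j k l, W i j k l = W k l i j)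
    (hbianchi : ∀ i j k l, W i j k l + W i k l j + W i l j k = 0)
    (htrace : ∀ i j, ∑ k, W k i k j = 0)
    (v : Fin 4 → ℝ)
    (hv : ∀ j k l, ∑ p, v p * W p j k l = 0) (hne : v ≠ 0) {a b c d : Fin 4}
    (hab : a ≠ b) (hac : a ≠ c) (had : a ≠ d) (hbc : b ≠ c) (hbd : b ≠ d) (hcd : c ≠ d) :
    W a b a b = 0 ∧ W a b a c = 0 ∧ W a b c d = 0 := by
  have hnorm : v a ^ 2 + v b ^ 2 + v c ^ 2 + v d ^ 2 ≠ 0 := by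
    rw [← sum_fin_four_eq_of_ne (fun p => v p ^ 2) hab hac had hbc hbd hcd]
    intro h
    rw [Finset.sum_eq_zero_iff_of_nonneg fun p _ => sq_nonneg (v p)] at h
    exact hne (funext fun p => pow_eq_zero_iff two_ne_zero |>.mp (h p (Finset.mem_univ p)))
  have hz1 : ∀ i k l, W i i k l = 0 := fun i k l => by linarith [hsym1 i i k l]
  have hz2 : ∀ i k l, W k l i i = 0 := fun i k l => by linarith [hsym2 k l i i]
  have ht : ∀ i j, W a i a j + W b i b j + W c i c j + W d i d j = 0 := fun i j => by
    rw [← sum_fin_four_eq_of_ne (fun p => W p i p j) hab hac had hbc hbd hcd, htrace]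
  have hw : ∀ i j l,
      v a * W a i j l + v b * W b i j l + v c * W c i j l + v d * W d i j l = 0 := fun i j l => by
    rw [← sum_fin_four_eq_of_ne (fun p => v p * W p i j l) hab hac had hbc hbd hcd, hv]
  have taa := ht a a
  have tbb := ht b b
  have tcc := ht c c
  have tdd := ht d d
  have tab := ht a b
  have tac := ht a c
  have tad := ht a d
  have tbc := ht b c
  have tbd := ht b d
  have tcd := ht c d
  have hb := hbianchi a b c d
  have waab := hw a a b
  have waac := hw a a c
  have waad := hw a a d
  have wabc := hw a b c
  have wabd := hw a b d
  have wacd := hw a c d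
  have wbab := hw b a b
  have wbac := hw b a c
  have wbad := hw b a d
  have wbbc := hw b b c
  have wbbd := hw b b d
  have wbcd := hw b c d
  -- Normalise every component to lexicographically sorted index pairs.
  simp only [hz1, hz2, hsym1 b a, hsym1 c a, hsym1 d a, hsym1 c b, hsym1 d b, hsym1 d c,
    hsym2 _ _ b a, hsym2 _ _ c a, hsym2 _ _ d a, hsym2 _ _ c b, hsym2 _ _ d b, hsym2 _ _ d c,
    hsym3 a c a b, hsym3 a d a b, hsym3 a d a c, hsym3 b c a b, hsym3 b c a c, hsym3 b c a d,
    hsym3 b d a b, hsym3 b d a c, hsym3 b d a d, hsym3 b d b c]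
    at taa tbb tcc tdd tab tac tad tbc tbd tcd hb
      waab waac waad wabc wabd wacd wbab wbac wbad wbbc wbbd wbcd
  have bdbd : W b d b d = W a c a c := by linarith
  have adad : W a d a d = -W a b a b - W a c a c := by linarith
  have bcbc : W b c b c = -W a b a b - W a c a c := by linarith
  have bdcd : W b d c d = -W a b a c := by linarith
  have bccd : W b c c d = W a b a d := by linarith
  have bcbd : W b c b d = -W a c a d := by linarith
  have adcd : W a d c d = W a b b c := by linarith
  have accd : W a c c d = -W a b b d := by linarith
  have adbd : W a d b d = -W a c b c := by linarith
  have adbc : W a d b c = W a c b d - W a b c d := by linarith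
  simp only [bdbd, adad, bcbc, bdcd, bccd, bcbd, adcd, accd, adbd, adbc]
    at waab waac waad wabc wabd wacd wbab wbac wbad wbbc wbbd wbcd
  refine ⟨?_, ?_, ?_⟩ <;> refine (mul_eq_zero.mp ?_).resolve_left hnorm
  · linear_combination -v b * waab + v c * waac + v d * waad + v a * wbab + v c * wbbc + v d * wbbd
  · linear_combination
      -v b * waac + v a * wbac - v b * wbbc - v c * waab - v a * wabc + v d * wbcd
  · linear_combination
      -v b * wacd + v d * wabc - v c * wabd + v a * wbcd - v d * wbac + v c * wbad

/-- Let `W` be an algebraic Weyl tensor on `ℝ⁴` and let `v ∈ ℝ⁴` satisfy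
`∑_p v_p W_{pjkl} = 0` for all indices `j, k, l`.  Then `v = 0` or `W = 0`. -/
theorem weyl_interior_product_vanishing
    (W : Fin 4 → Fin 4 → Fin 4 → Fin 4 → ℝ)
    (hsym1 : ∀ i j k l, W i j k l = -W j i k l)
    (hsym2 : ∀ i j k l, W i j k l = -W i j l k)
    (hsym3 : ∀ i j k l, W i j k l = W k l i j)
    (hbianchi : ∀ i j k l, W i j k l + W i k l j + W i l j k = 0)
    (htrace : ∀ i j, ∑ k, W k i k j = 0)
    (v : Fin 4 → ℝ)
    (hv : ∀ j k l, ∑ p, v p * W p j k l = 0) :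
    v = 0 ∨ W = 0 := by
  refine or_iff_not_imp_left.mpr fun hne => ?_
  ext i j k l
  rw [Pi.zero_apply, Pi.zero_apply, Pi.zero_apply, Pi.zero_apply]
  by_cases hij : i = j
  · subst hij
    linarith [hsym1 i i k l]
  by_cases hkl : k = l
  · subst hkl
    linarith [hsym2 i j k k]
  obtain ⟨c, d, hic, hid, hjc, hjd, hcd⟩ :
      ∃ c d : Fin 4, i ≠ c ∧ i ≠ d ∧ j ≠ c ∧ j ≠ d ∧ c ≠ d := by
    revert i j
    decide
  have hcover : ∀ m, m = i ∨ m = j ∨ m = c ∨ m = d := by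
    revert i j c d
    decide
  have hcomp := @weyl_components_eq_zero W hsym1 hsym2 hsym3 hbianchi htrace v hv hne
  obtain ⟨ijij, ijic, ijcd⟩ := hcomp hij hic hid hjc hjd hcd
  have ijid := (hcomp hij hid hic hjd hjc hcd.symm).2.1
  have jijc := (hcomp (Ne.symm hij) hjc hjd hic hid hcd).2.1
  have jijd := (hcomp (Ne.symm hij) hjd hjc hid hic hcd.symm).2.1
  rw [hsym1] at jijc jijd
  rcases hcover k with rfl | rfl | rfl | rfl <;> rcases hcover l with rfl | rfl | rfl | rfl <;>
    first
    | exact absurd rfl hkl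
    | linarith
    | (rw [hsym2]; linarith)
end

section
/- Let A be a symmetric real 3×3 matrix with tr A = 0, and put |A|² = tr(A²). Then 18·det A ≤ √6·|A|³, with equality if and only if the eigenvalues of A are −t, −t, 2t for some t ≥ 0. -/
theorem Matrix.IsHermitian.trace_mul_self_eq_sum_eigenvalues_sq {n : Type*} [Fintype n]
    [DecidableEq n] {A : Matrix n n ℝ} (hA : A.IsHermitian) :
    (A * A).trace = ∑ i, hA.eigenvalues i ^ 2 := by
  conv_lhs => rw [hA.spectral_theorem]
  rw [← map_mul, Unitary.conjStarAlgAut_apply, Matrix.trace_mul_cycle]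
  simp [Matrix.diagonal_mul_diagonal, Matrix.trace_diagonal, sq]

/-- The characteristic polynomial of a trace-free triple, evaluated at `2 * u`, where `6 * u ^ 2` is
the sum of the squares. -/
theorem two_mul_cube_sub_prod_eq {a b c u : ℝ} (h : a + b + c = 0)
    (hu : a ^ 2 + b ^ 2 + c ^ 2 = 6 * u ^ 2) :
    2 * u ^ 3 - a * b * c = (2 * u - a) * (2 * u - b) * (2 * u - c) := by
  obtain rfl : c = -a - b := by linarith
  linear_combination u * hu

theorem le_two_mul_of_sum_eq_zero {a b c u : ℝ} (h : a + b + c = 0) (hu0 : 0 ≤ u)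
    (hu : a ^ 2 + b ^ 2 + c ^ 2 = 6 * u ^ 2) : a ≤ 2 * u := by
  obtain rfl : c = -a - b := by linarith
  apply le_of_sq_le_sq _ (by positivity)
  nlinarith [sq_nonneg (a + 2 * b)]

theorem eq_neg_of_eq_two_mul {a b c u : ℝ} (h : a + b + c = 0)
    (hu : a ^ 2 + b ^ 2 + c ^ 2 = 6 * u ^ 2) (hc : c = 2 * u) : a = -u ∧ b = -u := by
  subst hc
  obtain rfl : b = -a - 2 * u := by linarith
  have : a + u = 0 := pow_eq_zero_iff two_ne_zero |>.1 (by linear_combination hu / 2)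
  constructor <;> linarith

theorem sqrt_six_mul_sqrt_pow_three (s : ℝ) :
    √6 * √s ^ 3 = 36 * √(s / 6) ^ 3 := by
  have h6 : √6 ^ 2 = 6 := Real.sq_sqrt (by norm_num)
  have : √s = √6 * √(s / 6) := by
    rw [← Real.sqrt_mul (by norm_num)]
    congr 1
    ring
  rw [this]
  linear_combination √(s / 6) ^ 3 * (√6 ^ 2 + 6) * h6

/-- Let `A` be a symmetric real 3×3 matrix with `tr A = 0`, and put
`|A|² = tr(A²)`.  Then `18·det A ≤ √6·|A|³`, with equality if and only if the eigenvalues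
of `A` are `−t, −t, 2t` for some `t ≥ 0`. -/
theorem det_bound_traceless_symmetric
    (A : Matrix (Fin 3) (Fin 3) ℝ) (hA : A.IsHermitian) (htr : A.trace = 0) :
    18 * A.det ≤ Real.sqrt 6 * Real.sqrt ((A * A).trace) ^ 3 ∧
    (18 * A.det = Real.sqrt 6 * Real.sqrt ((A * A).trace) ^ 3 ↔
      ∃ t : ℝ, 0 ≤ t ∧ ∃ σ : Equiv.Perm (Fin 3),
        ∀ i, hA.eigenvalues (σ i) = ![-t, -t, 2 * t] i) := by
  have hdet : A.det = ∏ i, hA.eigenvalues i := by simpa using hA.det_eq_prod_eigenvalues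
  have hsum : ∑ i, hA.eigenvalues i = 0 := by
    simpa [htr] using hA.trace_eq_sum_eigenvalues.symm
  rw [hA.trace_mul_self_eq_sum_eigenvalues_sq, hdet]
  generalize hA.eigenvalues = f at *
  rw [sqrt_six_mul_sqrt_pow_three]
  set u := √((∑ i, f i ^ 2) / 6) with hu_def
  have hu0 : 0 ≤ u := Real.sqrt_nonneg _
  have hu : ∑ i, f i ^ 2 = 6 * u ^ 2 := by
    rw [hu_def, Real.sq_sqrt (by positivity)]
    ring
  have key (σ : Equiv.Perm (Fin 3)) : f (σ 0) + f (σ 1) + f (σ 2) = 0 ∧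
      f (σ 0) ^ 2 + f (σ 1) ^ 2 + f (σ 2) ^ 2 = 6 * u ^ 2 := by
    rw [← Equiv.sum_comp σ, Fin.sum_univ_three] at hsum hu
    exact ⟨hsum, hu⟩
  have hle (i : Fin 3) : f i ≤ 2 * u := by
    obtain ⟨h₁, h₂⟩ := key (Equiv.swap 0 i)
    simpa using le_two_mul_of_sum_eq_zero h₁ hu0 h₂
  have hprod : 2 * u ^ 3 - ∏ i, f i = ∏ i, (2 * u - f i) := by
    obtain ⟨h₁, h₂⟩ := key 1
    simpa [Fin.prod_univ_three] using two_mul_cube_sub_prod_eq h₁ h₂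
  have hnonneg : 0 ≤ ∏ i, (2 * u - f i) :=
    Finset.prod_nonneg fun i _ => sub_nonneg.2 (hle i)
  refine ⟨by linarith, fun heq => ?_, ?_⟩
  · have hzero : ∏ i, (2 * u - f i) = 0 := by linarith
    obtain ⟨i, -, hi⟩ := Finset.prod_eq_zero_iff.1 hzero
    obtain ⟨h₁, h₂⟩ := key (Equiv.swap 2 i)
    have hlast : f (Equiv.swap 2 i 2) = 2 * u := by
      rw [Equiv.swap_apply_left]
      linarith
    obtain ⟨h₃, h₄⟩ := eq_neg_of_eq_two_mul h₁ h₂ hlast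
    refine ⟨u, hu0, Equiv.swap 2 i, fun j => ?_⟩
    fin_cases j
    exacts [h₃, h₄, hlast]
  · rintro ⟨t, ht, σ, hσ⟩
    have h0 : f (σ 0) = -t := hσ 0
    have h1 : f (σ 1) = -t := hσ 1
    have h2 : f (σ 2) = 2 * t := hσ 2
    have hut : u = t := by
      have h := (key σ).2
      rw [h0, h1, h2] at h
      exact (sq_eq_sq₀ hu0 ht).1 (by linarith)
    rw [← Equiv.prod_comp σ, Fin.prod_univ_three, h0, h1, h2, hut]
    ring
end

section
/- Let n > 3, let A be a symmetric n×n real matrix, v ∈ ℝⁿ, and let a, b, c ∈ ℝ with a ≠ 0. If a·Q(X,Y,Z) + b·M(X,Y,Z) + c·N(X,Y,Z) = 0 for all X, Y, Z ∈ ℝⁿ, then there exists μ ∈ ℝ with Av = μv; and if in addition v ≠ 0 and b ≠ 0, then every vector u orthogonal to v satisfies Au = ((2aμ − c)/b)·u, i.e. all eigenvalues of A other than the one on v coincide. -/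
open scoped Matrix

/-- In dimension greater than two, any two vectors have a common nonzero orthogonal vector. -/
theorem exists_ne_zero_orthogonal_pair {n : ℕ} (hn : 2 < n) (p q : Fin n → ℝ) :
    ∃ x : Fin n → ℝ, x ≠ 0 ∧ p ⬝ᵥ x = 0 ∧ q ⬝ᵥ x = 0 := by
  have hker : LinearMap.ker (Matrix.mulVecLin (Matrix.of ![p, q])) ≠ ⊥ :=
    LinearMap.ker_ne_bot_of_finrank_lt (by simpa using hn)
  obtain ⟨x, hx, hx0⟩ := Submodule.exists_mem_ne_zero_of_ne_bot hker
  rw [LinearMap.mem_ker, Matrix.mulVecLin_apply] at hx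
  exact ⟨x, hx0, congrFun hx 0, congrFun hx 1⟩

/-- If `(w ⬝ᵥ y) x = (w ⬝ᵥ x) y` for all `x, y` orthogonal to a nonzero vector `v` in dimension
greater than two, then `w` is a multiple of `v`. -/
theorem exists_eq_smul_of_forall_orthogonal {n : ℕ} (hn : 2 < n) {v w : Fin n → ℝ} (hv : v ≠ 0)
    (h : ∀ x y : Fin n → ℝ, v ⬝ᵥ x = 0 → v ⬝ᵥ y = 0 → (w ⬝ᵥ y) • x = (w ⬝ᵥ x) • y) :
    ∃ r : ℝ, w = r • v := by
  have hvv : v ⬝ᵥ v ≠ 0 := fun h0 => hv (dotProduct_self_eq_zero.mp h0)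
  set r : ℝ := (v ⬝ᵥ w) / (v ⬝ᵥ v) with hr
  set p : Fin n → ℝ := w - r • v with hp
  have hvp : v ⬝ᵥ p = 0 := by
    rw [hp, dotProduct_sub, dotProduct_smul, smul_eq_mul, hr, div_mul_cancel₀ _ hvv, sub_self]
  have hw : w = p + r • v := by rw [hp]; abel
  obtain ⟨x, hx0, hvx, hpx⟩ := exists_ne_zero_orthogonal_pair hn v p
  have hwx : w ⬝ᵥ x = 0 := by
    rw [hw, add_dotProduct, smul_dotProduct, hpx, hvx, smul_zero, add_zero]
  have hwp : w ⬝ᵥ p = p ⬝ᵥ p := by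
    conv_lhs => rw [hw, add_dotProduct, smul_dotProduct, hvp, smul_zero, add_zero]
  have key := h x p hvx hvp
  rw [hwx, hwp, zero_smul] at key
  have hp0 : p = 0 := dotProduct_self_eq_zero.mp ((smul_eq_zero.mp key).resolve_right hx0)
  exact ⟨r, sub_eq_zero.mp hp0⟩

/-- Let `n > 3`, `A` a symmetric `n×n` real matrix, `v ∈ ℝⁿ`, `w = 2Av`,
and `a, b, c ∈ ℝ` with `a ≠ 0`.  If `a·Q + b·M + c·N ≡ 0` (with `Q, M, N` the trilinear
forms built from `A, v, w`), then there exists `μ` with `Av = μv`; and if in addition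
`v ≠ 0` and `b ≠ 0`, then every `u ⊥ v` satisfies `Au = ((2aμ − c)/b)·u`. -/
theorem combination_vanishing_implies_eigen
    {n : ℕ} (hn : 3 < n)
    (A : Matrix (Fin n) (Fin n) ℝ) (hA : A.IsSymm)
    (v : Fin n → ℝ) (a b c : ℝ) (ha : a ≠ 0)
    (w : Fin n → ℝ) (hw : w = fun i => 2 * A.mulVec v i)
    (hT : ∀ X Y Z : Fin n → ℝ,
      a * ((∑ i, X i * Z i) * (∑ i, w i * Y i) - (∑ i, Y i * Z i) * (∑ i, w i * X i))
        + b * ((∑ i, A.mulVec Y i * Z i) * (∑ i, v i * X i)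
            - (∑ i, A.mulVec X i * Z i) * (∑ i, v i * Y i))
        + c * ((∑ i, Y i * Z i) * (∑ i, v i * X i)
            - (∑ i, X i * Z i) * (∑ i, v i * Y i)) = 0) :
    ∃ μ : ℝ, A.mulVec v = μ • v ∧
      (v ≠ 0 → b ≠ 0 → ∀ u : Fin n → ℝ, (∑ i, u i * v i) = 0 →
        A.mulVec u = ((2 * a * μ - c) / b) • u) := by
  have hV : ∀ (X Y : Fin n → ℝ) (j : Fin n),
      a * (X j * (w ⬝ᵥ Y) - Y j * (w ⬝ᵥ X))
        + b * (A.mulVec Y j * (v ⬝ᵥ X) - A.mulVec X j * (v ⬝ᵥ Y))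
        + c * (Y j * (v ⬝ᵥ X) - X j * (v ⬝ᵥ Y)) = 0 := by
    intro X Y j
    simpa [dotProduct, Pi.single_apply] using hT X Y (Pi.single j 1)
  by_cases hv : v = 0
  · exact ⟨0, by simp [hv], fun h => absurd hv h⟩
  obtain ⟨r, hr⟩ := exists_eq_smul_of_forall_orthogonal (v := v) (w := w) (by omega) hv (by
    intro x y hx hy
    ext j
    have h := hV x y j
    rw [hx, hy] at h
    simp only [mul_zero, sub_self, add_zero, mul_eq_zero, ha, false_or] at h
    simp only [Pi.smul_apply, smul_eq_mul]
    linarith)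
  refine ⟨r / 2, ?_, ?_⟩
  · ext j
    have h := congrFun (hw.symm.trans hr) j
    simp only [Pi.smul_apply, smul_eq_mul] at h ⊢
    linarith
  · intro _ hb u hu
    have hvu : v ⬝ᵥ u = 0 := by rw [dotProduct_comm]; exact hu
    have hvv : v ⬝ᵥ v ≠ 0 := fun h0 => hv (dotProduct_self_eq_zero.mp h0)
    ext j
    have h := hV u v j
    rw [hr, smul_dotProduct, smul_dotProduct, hvu, smul_eq_mul, smul_eq_mul] at h
    have h' : (a * r * u j - b * A.mulVec u j - c * u j) * (v ⬝ᵥ v) = 0 := by linarith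
    have h2 := (mul_eq_zero.mp h').resolve_right hvv
    rw [Pi.smul_apply, smul_eq_mul]
    field_simp
    linarith
end

section
/- Let A be a symmetric 4×4 real matrix, v ∈ ℝ⁴, and a, b, c ∈ ℝ. For an antisymmetric bivector α and Z ∈ ℝ⁴ set T(α, Z) = −2a⟨α(Z), Av⟩ − b⟨α(v), AZ⟩ + c⟨α(Z), v⟩. If T(α, Z) = 0 for every self-dual bivector α and every Z ∈ ℝ⁴, then T(β, Z) = 0 for every bivector β and every Z ∈ ℝ⁴. -/
open Matrix

/-- An antisymmetric matrix is skew-adjoint for the dot product. -/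
lemma mulVec_dotProduct_of_antisymm {n R : Type*} [Fintype n] [CommRing R] {β : Matrix n n R}
    (hβ : ∀ i j, β i j = -β j i) (x y : n → R) :
    β *ᵥ x ⬝ᵥ y = -(x ⬝ᵥ β *ᵥ y) := by
  have h : βᵀ = -β := by
    ext i j
    simpa using hβ j i
  rw [dotProduct_mulVec, ← mulVec_transpose, h, neg_mulVec, neg_dotProduct, neg_neg]

/-- The self-dual antisymmetric matrix with first row `(0, p, q, r)`. -/
def selfDualMatrix (p q r : ℝ) : Matrix (Fin 4) (Fin 4) ℝ :=
  !![0, p, q, r; -p, 0, r, -q; -q, -r, 0, p; -r, q, -p, 0]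

lemma selfDualMatrix_antisymm (p q r : ℝ) (i j : Fin 4) :
    selfDualMatrix p q r i j = -selfDualMatrix p q r j i := by
  fin_cases i <;> fin_cases j <;> simp [selfDualMatrix]

lemma selfDualMatrix_mulVec (p q r : ℝ) (x : Fin 4 → ℝ) :
    selfDualMatrix p q r *ᵥ x =
      ![p * x 1 + q * x 2 + r * x 3, -p * x 0 + r * x 2 - q * x 3,
        -q * x 0 - r * x 1 + p * x 3, -r * x 0 + q * x 1 - p * x 2] := by
  ext i
  fin_cases i <;> simp [selfDualMatrix, mulVec, dotProduct, Fin.sum_univ_four] <;> ring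

/-- For `v ≠ 0`, the orthogonal complement of `v` consists of the images of `v` under
self-dual bivectors. -/
lemma exists_selfDualMatrix_mulVec_eq {v u : Fin 4 → ℝ} (hv : v ≠ 0) (huv : u ⬝ᵥ v = 0) :
    ∃ p q r, selfDualMatrix p q r *ᵥ v = u := by
  obtain ⟨s, hs⟩ : ∃ s, v ⬝ᵥ v = s := ⟨_, rfl⟩
  have hs₀ : s ≠ 0 := fun h => hv (dotProduct_self_eq_zero.mp (hs.trans h))
  refine ⟨(u ⬝ᵥ selfDualMatrix 1 0 0 *ᵥ v) / s, (u ⬝ᵥ selfDualMatrix 0 1 0 *ᵥ v) / s,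
    (u ⬝ᵥ selfDualMatrix 0 0 1 *ᵥ v) / s, ?_⟩
  simp only [selfDualMatrix_mulVec]
  simp only [dotProduct, Fin.sum_univ_four] at hs huv ⊢
  ext i
  fin_cases i <;> simp <;> field_simp
  · linear_combination u 0 * hs - v 0 * huv
  · linear_combination u 1 * hs - v 1 * huv
  · linear_combination u 2 * hs - v 2 * huv
  · linear_combination u 3 * hs - v 3 * huv

/-- If a symmetric matrix `M` maps `β v` to `β w` for every self-dual `β`, with `v ≠ 0`, then `w` is
a multiple of `v`. -/
lemma exists_eq_smul_of_selfDualMatrix {M : Matrix (Fin 4) (Fin 4) ℝ} (hM : M.IsSymm)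
    {v w : Fin 4 → ℝ} (hv : v ≠ 0)
    (h : ∀ p q r, M *ᵥ (selfDualMatrix p q r *ᵥ v) = selfDualMatrix p q r *ᵥ w) :
    ∃ μ : ℝ, w = μ • v := by
  obtain ⟨s, hs⟩ : ∃ s, v ⬝ᵥ v = s := ⟨_, rfl⟩
  have hs₀ : s ≠ 0 := fun h => hv (dotProduct_self_eq_zero.mp (hs.trans h))
  have key (p q r p' q' r' : ℝ) :
      selfDualMatrix p q r *ᵥ w ⬝ᵥ selfDualMatrix p' q' r' *ᵥ v =
        selfDualMatrix p' q' r' *ᵥ w ⬝ᵥ selfDualMatrix p q r *ᵥ v := by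
    rw [← h, ← h, dotProduct_comm, dotProduct_mulVec, ← mulVec_transpose, hM.eq]
  have h₁ := key 0 1 0 0 0 1
  have h₂ := key 0 0 1 1 0 0
  have h₃ := key 1 0 0 0 1 0
  refine ⟨(w ⬝ᵥ v) / s, ?_⟩
  simp only [selfDualMatrix_mulVec] at h₁ h₂ h₃
  simp [dotProduct, Fin.sum_univ_four] at hs h₁ h₂ h₃ ⊢
  ext i
  fin_cases i <;> simp <;> field_simp
  · linear_combination (v 1 * h₁ + v 2 * h₂ + v 3 * h₃) / 2 - w 0 * hs
  · linear_combination (-v 0 * h₁ + v 2 * h₃ - v 3 * h₂) / 2 - w 1 * hs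
  · linear_combination (-v 0 * h₂ - v 1 * h₃ + v 3 * h₁) / 2 - w 2 * hs
  · linear_combination (-v 0 * h₃ + v 1 * h₂ - v 2 * h₁) / 2 - w 3 * hs


/-- Let `A` be a symmetric 4×4 real matrix, `v ∈ ℝ⁴`, `a, b, c ∈ ℝ`,
and for an antisymmetric bivector `β` (acting on vectors by `β.mulVec`) and `Z ∈ ℝ⁴` set
`T(β, Z) = −2a⟨β(Z), Av⟩ − b⟨β(v), AZ⟩ + c⟨β(Z), v⟩`.  If `T(β, Z) = 0` for every
self-dual bivector `β` and every `Z`, then `T(β, Z) = 0` for every bivector `β` and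
every `Z`.  (A bivector is self-dual iff `β₁₂ = β₃₄`, `β₁₃ = −β₂₄`, `β₁₄ = β₂₃`.) -/
theorem vanishing_on_selfDual_implies_vanishing
    (A : Matrix (Fin 4) (Fin 4) ℝ) (hA : A.IsSymm) (v : Fin 4 → ℝ) (a b c : ℝ)
    (T : Matrix (Fin 4) (Fin 4) ℝ → (Fin 4 → ℝ) → ℝ)
    (hT : ∀ β Z, T β Z =
      -2 * a * (∑ i, β.mulVec Z i * A.mulVec v i)
        - b * (∑ i, β.mulVec v i * A.mulVec Z i)
        + c * (∑ i, β.mulVec Z i * v i))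
    (hsd : ∀ β : Matrix (Fin 4) (Fin 4) ℝ, (∀ i j, β i j = -β j i) →
      β 0 1 = β 2 3 → β 0 2 = -β 1 3 → β 0 3 = β 1 2 → ∀ Z, T β Z = 0) :
    ∀ β : Matrix (Fin 4) (Fin 4) ℝ, (∀ i j, β i j = -β j i) → ∀ Z, T β Z = 0 := by
  set w : Fin 4 → ℝ := (2 * a) • (A *ᵥ v) - c • v with hw
  have hT' (β : Matrix (Fin 4) (Fin 4) ℝ) (hβ : ∀ i j, β i j = -β j i) (Z : Fin 4 → ℝ) :
      T β Z = Z ⬝ᵥ (β *ᵥ w - (b • A) *ᵥ (β *ᵥ v)) := by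
    have h₁ := mulVec_dotProduct_of_antisymm hβ Z (A *ᵥ v)
    have h₂ := mulVec_dotProduct_of_antisymm hβ Z v
    have h₃ : β *ᵥ v ⬝ᵥ A *ᵥ Z = Z ⬝ᵥ A *ᵥ (β *ᵥ v) := by
      rw [dotProduct_mulVec, ← mulVec_transpose, hA.eq, dotProduct_comm]
    have h₄ : T β Z = -2 * a * (β *ᵥ Z ⬝ᵥ A *ᵥ v) - b * (β *ᵥ v ⬝ᵥ A *ᵥ Z)
        + c * (β *ᵥ Z ⬝ᵥ v) := hT β Z
    rw [h₄, h₁, h₂, h₃, hw]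
    simp only [mulVec_sub, mulVec_smul, smul_mulVec, dotProduct_sub, dotProduct_smul, smul_eq_mul]
    ring
  have h (p q r : ℝ) :
      (b • A) *ᵥ (selfDualMatrix p q r *ᵥ v) = selfDualMatrix p q r *ᵥ w := by
    have hβ := selfDualMatrix_antisymm p q r
    refine (sub_eq_zero.mp (dotProduct_eq_zero _ fun Z => ?_)).symm
    rw [dotProduct_comm, ← hT' _ hβ]
    exact hsd _ hβ (by simp [selfDualMatrix]) (by simp [selfDualMatrix])
      (by simp [selfDualMatrix]) Z
  intro β hβ Z
  rw [hT' β hβ]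
  by_cases hv : v = 0
  · simp [hw, hv]
  obtain ⟨μ, hμ⟩ := exists_eq_smul_of_selfDualMatrix (hA.smul b) hv h
  have huv : β *ᵥ v ⬝ᵥ v = 0 := by
    have := mulVec_dotProduct_of_antisymm hβ v v
    rw [dotProduct_comm v] at this
    linarith
  obtain ⟨p, q, r, hu⟩ := exists_selfDualMatrix_mulVec_eq hv huv
  rw [← hu, h, hμ, mulVec_smul, mulVec_smul, hu, sub_self, dotProduct_zero]
end

section
/- Let n > 3, let A be a symmetric n×n real matrix with S = tr A, and let v ∈ ℝⁿ with v ≠ 0. Define the trilinear form D(X,Y,Z) = −Q(X,Y,Z)/(2(n−1)(n−2)) + M(X,Y,Z)/(n−2) − S·N(X,Y,Z)/((n−1)(n−2)). Then D(X,Y,Z) = 0 for all X, Y, Z ∈ ℝⁿ if and only if there exists μ ∈ ℝ such that Av = μv and Au = ((S−μ)/(n−1))·u for every u orthogonal to v. -/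
open Matrix in
/-- The trilinear form `D`, scaled by `(n - 1) (n - 2)` and with `c` in place of `n - 1`, vanishes
iff `v` is an eigenvector of `A` and `A` is the appropriate scalar on the complement of `v`. -/
theorem scaled_form_eq_zero_iff {ι : Type*} [Fintype ι] {c S : ℝ} (hc : c ≠ 0) (hc1 : c ≠ 1)
    {A : Matrix ι ι ℝ} (hA : A.IsSymm) {v : ι → ℝ} (hv : v ≠ 0) :
    (∀ X Y Z : ι → ℝ,
      c * ((A *ᵥ Y) ⬝ᵥ Z * (v ⬝ᵥ X) - (A *ᵥ X) ⬝ᵥ Z * (v ⬝ᵥ Y))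
        - (X ⬝ᵥ Z * ((A *ᵥ v) ⬝ᵥ Y) - Y ⬝ᵥ Z * ((A *ᵥ v) ⬝ᵥ X))
        - S * (Y ⬝ᵥ Z * (v ⬝ᵥ X) - X ⬝ᵥ Z * (v ⬝ᵥ Y)) = 0) ↔
    ∃ μ : ℝ, A *ᵥ v = μ • v ∧ ∀ u : ι → ℝ, u ⬝ᵥ v = 0 → A *ᵥ u = ((S - μ) / c) • u := by
  have hvv : v ⬝ᵥ v ≠ 0 := fun h => hv (dotProduct_self_eq_zero.mp h)
  constructor
  · intro h
    have hAu (u : ι → ℝ) (hu : u ⬝ᵥ v = 0) : (A *ᵥ v) ⬝ᵥ u = 0 := by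
      have hs : (A *ᵥ u) ⬝ᵥ v = (A *ᵥ v) ⬝ᵥ u := by
        rw [dotProduct_comm, dotProduct_mulVec, ← mulVec_transpose, hA.eq]
      have h1 := h v u v
      rw [hu, dotProduct_comm v u, hu, hs] at h1
      have h2 : (c - 1) * (v ⬝ᵥ v) * ((A *ᵥ v) ⬝ᵥ u) = 0 := by linear_combination h1
      exact (mul_eq_zero.mp h2).resolve_left (mul_ne_zero (sub_ne_zero.mpr hc1) hvv)
    set μ := (A *ᵥ v) ⬝ᵥ v / (v ⬝ᵥ v) with hμ
    have hμ' : (A *ᵥ v) ⬝ᵥ v = μ * (v ⬝ᵥ v) := by rw [hμ]; field_simp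
    refine ⟨μ, ?_, fun u hu => ?_⟩
    · have h1 : (A *ᵥ v - μ • v) ⬝ᵥ v = 0 := by
        rw [sub_dotProduct, smul_dotProduct, smul_eq_mul, hμ', sub_self]
      refine sub_eq_zero.mp (dotProduct_self_eq_zero.mp ?_)
      rw [sub_dotProduct, hAu _ h1, smul_dotProduct, dotProduct_comm v, h1, smul_zero, sub_zero]
    · refine dotProduct_eq _ _ fun z => ?_
      have h1 := h v u z
      rw [dotProduct_comm v u, hu, hAu u hu, hμ'] at h1
      rw [smul_dotProduct, smul_eq_mul, div_mul_eq_mul_div, eq_div_iff hc]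
      refine mul_right_cancel₀ hvv ?_
      linear_combination h1
  · rintro ⟨μ, hμ, hu⟩
    have hdecomp (X Z : ι → ℝ) : (A *ᵥ X) ⬝ᵥ Z =
        (S - μ) / c * (X ⬝ᵥ Z) + (μ - (S - μ) / c) / (v ⬝ᵥ v) * (v ⬝ᵥ X) * (v ⬝ᵥ Z) := by
      have h1 := hu (X - (v ⬝ᵥ X / (v ⬝ᵥ v)) • v) (by
        rw [sub_dotProduct, smul_dotProduct, smul_eq_mul, dotProduct_comm X]
        field_simp
        ring)
      rw [mulVec_sub, mulVec_smul, hμ] at h1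
      have h2 := congrArg (· ⬝ᵥ Z) h1
      simp only [sub_dotProduct, smul_dotProduct, smul_eq_mul] at h2
      linear_combination h2
    intro X Y Z
    rw [hdecomp X, hdecomp Y, hμ]
    simp only [smul_dotProduct, smul_eq_mul]
    field_simp
    ring


/-- Let `n > 3`, `A` a symmetric `n×n` real matrix with `S = tr A`,
`v ≠ 0`, `w = 2Av`.  Define
`D(X,Y,Z) = −Q(X,Y,Z)/(2(n−1)(n−2)) + M(X,Y,Z)/(n−2) − S·N(X,Y,Z)/((n−1)(n−2))`.
Then `D ≡ 0` iff there is `μ` with `Av = μv` and `Au = ((S−μ)/(n−1))·u` for every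
`u ⊥ v`. -/
theorem D_vanishing_characterization
    {n : ℕ} (hn : 3 < n)
    (A : Matrix (Fin n) (Fin n) ℝ) (hA : A.IsSymm)
    (S : ℝ) (hS : S = A.trace)
    (v : Fin n → ℝ) (hv : v ≠ 0)
    (w : Fin n → ℝ) (hw : w = fun i => 2 * A.mulVec v i)
    (Q M N : (Fin n → ℝ) → (Fin n → ℝ) → (Fin n → ℝ) → ℝ)
    (hQ : ∀ X Y Z, Q X Y Z =
      (∑ i, X i * Z i) * (∑ i, w i * Y i) - (∑ i, Y i * Z i) * (∑ i, w i * X i))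
    (hM : ∀ X Y Z, M X Y Z =
      (∑ i, A.mulVec Y i * Z i) * (∑ i, v i * X i)
        - (∑ i, A.mulVec X i * Z i) * (∑ i, v i * Y i))
    (hN : ∀ X Y Z, N X Y Z =
      (∑ i, Y i * Z i) * (∑ i, v i * X i) - (∑ i, X i * Z i) * (∑ i, v i * Y i)) :
    (∀ X Y Z : Fin n → ℝ,
        -Q X Y Z / (2 * ((n : ℝ) - 1) * ((n : ℝ) - 2)) + M X Y Z / ((n : ℝ) - 2)
          - S * N X Y Z / (((n : ℝ) - 1) * ((n : ℝ) - 2)) = 0) ↔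
      ∃ μ : ℝ, A.mulVec v = μ • v ∧
        ∀ u : Fin n → ℝ, (∑ i, u i * v i) = 0 →
          A.mulVec u = ((S - μ) / ((n : ℝ) - 1)) • u := by
  have hn' : (3 : ℝ) < n := by exact_mod_cast hn
  have hc : (n : ℝ) - 1 ≠ 0 := by linarith
  have hd : (n : ℝ) - 2 ≠ 0 := by linarith
  refine Iff.trans ?_ (scaled_form_eq_zero_iff hc (fun h => hd (by linarith)) hA hv)
  refine forall_congr' fun X => forall_congr' fun Y => forall_congr' fun Z => ?_
  have hw' (U : Fin n → ℝ) : ∑ i, w i * U i = 2 * (A.mulVec v ⬝ᵥ U) := by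
    simp only [hw, dotProduct, Finset.mul_sum, mul_assoc]
  rw [hQ, hM, hN, hw', hw']
  simp only [← dotProduct.eq_1]
  rw [← mul_eq_zero_iff_left (mul_ne_zero hc hd)]
  refine Eq.congr_left ?_
  field_simp
  ring
end

section
/- Let A be a symmetric n×n real matrix with S = tr A and Frobenius norm |A|, and let v ∈ ℝⁿ with w = 2Av. Then: ∑_{i,j,k} (Q_{ijk})² = 2(n−1)|w|²; ∑_{i,j,k} (M_{ijk})² = 2|A|²|v|² − (1/2)|w|²; ∑_{i,j,k} (N_{ijk})² = 2(n−1)|v|²; ∑_{i,j,k} Q_{ijk}M_{ijk} = |w|² − 2S⟨v,w⟩; ∑_{i,j,k} Q_{ijk}N_{ijk} = −2(n−1)⟨v,w⟩; ∑_{i,j,k} M_{ijk}N_{ijk} = 2S|v|² − ⟨v,w⟩. -/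
open Matrix

/-- The pairing of two 3-tensors of the form `B k j * x i - B k i * x j`. -/
theorem sum_antisymm_mul_antisymm {ι R : Type*} [Fintype ι] [CommRing R]
    (B C : Matrix ι ι R) (x y : ι → R) :
    ∑ i, ∑ j, ∑ k, (B k j * x i - B k i * x j) * (C k j * y i - C k i * y j) =
      2 * (∑ i, ∑ j, B i j * C i j) * (x ⬝ᵥ y) - 2 * ((B *ᵥ y) ⬝ᵥ (C *ᵥ x)) := by
  have h₁ : ∑ i, ∑ j, ∑ k, (B k j * C k j) * (x i * y i) =
      (∑ i, ∑ j, B i j * C i j) * (x ⬝ᵥ y) := by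
    rw [Finset.sum_comm (f := fun i j => B i j * C i j), mul_comm]
    simp only [dotProduct, Finset.mul_sum, mul_comm]
    exact Finset.sum_comm
  have h₂ : ∑ i, ∑ j, ∑ k, (B k j * y j) * (C k i * x i) = (B *ᵥ y) ⬝ᵥ (C *ᵥ x) := by
    simp only [dotProduct, mulVec, Finset.sum_mul_sum]
    rw [Finset.sum_comm]
    simp only [fun j => Finset.sum_comm (s := Finset.univ) (t := Finset.univ)
      (f := fun i k => B k j * y j * (C k i * x i))]
    exact Finset.sum_comm
  have h₁' : ∑ i, ∑ j, ∑ k, (B k i * C k i) * (x j * y j) =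
      (∑ i, ∑ j, B i j * C i j) * (x ⬝ᵥ y) := by rw [← h₁, Finset.sum_comm]
  have h₂' : ∑ i, ∑ j, ∑ k, (B k i * y i) * (C k j * x j) =
      (B *ᵥ y) ⬝ᵥ (C *ᵥ x) := by rw [← h₂, Finset.sum_comm]
  calc _ = ∑ i, ∑ j, ∑ k, ((B k j * C k j) * (x i * y i) + (B k i * C k i) * (x j * y j)
        - (B k j * y j) * (C k i * x i) - (B k i * y i) * (C k j * x j)) := by
        congr! 3; ring
    _ = _ := by
        simp only [Finset.sum_add_distrib, Finset.sum_sub_distrib, h₁, h₁', h₂, h₂']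
        ring

/-- For a symmetric `n×n` real matrix `A` with `S = tr A`, a vector `v`
and `w = 2Av`, with the 3-tensors `Q_{ijk} = δ_{ki}w_j − δ_{kj}w_i`,
`M_{ijk} = A_{kj}v_i − A_{ki}v_j`, `N_{ijk} = δ_{kj}v_i − δ_{ki}v_j`, one has:
`∑Q² = 2(n−1)|w|²`, `∑M² = 2|A|²|v|² − |w|²/2`, `∑N² = 2(n−1)|v|²`,
`∑QM = |w|² − 2S⟨v,w⟩`, `∑QN = −2(n−1)⟨v,w⟩`, `∑MN = 2S|v|² − ⟨v,w⟩`. -/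
theorem norm_products_QMN
    {n : ℕ} (A : Matrix (Fin n) (Fin n) ℝ) (hA : A.IsSymm)
    (v : Fin n → ℝ) (S : ℝ) (hS : S = A.trace)
    (w : Fin n → ℝ) (hw : w = fun i => 2 * A.mulVec v i)
    (Q M N : Fin n → Fin n → Fin n → ℝ)
    (hQ : ∀ i j k, Q i j k =
      (if k = i then (1 : ℝ) else 0) * w j - (if k = j then (1 : ℝ) else 0) * w i)
    (hM : ∀ i j k, M i j k = A k j * v i - A k i * v j)
    (hN : ∀ i j k, N i j k =
      (if k = j then (1 : ℝ) else 0) * v i - (if k = i then (1 : ℝ) else 0) * v j) :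
    (∑ i, ∑ j, ∑ k, (Q i j k) ^ 2) = 2 * ((n : ℝ) - 1) * (∑ i, (w i) ^ 2) ∧
    (∑ i, ∑ j, ∑ k, (M i j k) ^ 2) =
      2 * (∑ i, ∑ j, (A i j) ^ 2) * (∑ i, (v i) ^ 2) - (1 / 2) * (∑ i, (w i) ^ 2) ∧
    (∑ i, ∑ j, ∑ k, (N i j k) ^ 2) = 2 * ((n : ℝ) - 1) * (∑ i, (v i) ^ 2) ∧
    (∑ i, ∑ j, ∑ k, Q i j k * M i j k) = (∑ i, (w i) ^ 2) - 2 * S * (∑ i, v i * w i) ∧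
    (∑ i, ∑ j, ∑ k, Q i j k * N i j k) = -2 * ((n : ℝ) - 1) * (∑ i, v i * w i) ∧
    (∑ i, ∑ j, ∑ k, M i j k * N i j k) = 2 * S * (∑ i, (v i) ^ 2) - (∑ i, v i * w i) := by
  have hQ' : ∀ i j k, Q i j k =
      (1 : Matrix (Fin n) (Fin n) ℝ) k j * (-w) i - (1 : Matrix (Fin n) (Fin n) ℝ) k i * (-w) j := by
    intro i j k
    rw [hQ, Matrix.one_apply, Matrix.one_apply, Pi.neg_apply, Pi.neg_apply]
    ring
  have hN' : ∀ i j k, N i j k =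
      (1 : Matrix (Fin n) (Fin n) ℝ) k j * v i - (1 : Matrix (Fin n) (Fin n) ℝ) k i * v j := by
    intro i j k
    rw [hN, Matrix.one_apply, Matrix.one_apply]
  have hwA : w = (2 : ℝ) • A *ᵥ v := by
    rw [hw]
    rfl
  have hone : ∑ i, ∑ j, (1 : Matrix (Fin n) (Fin n) ℝ) i j * (1 : Matrix (Fin n) (Fin n) ℝ) i j
      = n := by
    simp [Matrix.one_apply]
  have htrace : ∑ i, ∑ j, (1 : Matrix (Fin n) (Fin n) ℝ) i j * A i j = S := by
    simp [Matrix.one_apply, hS, Matrix.trace]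
  have htrace' : ∑ i, ∑ j, A i j * (1 : Matrix (Fin n) (Fin n) ℝ) i j = S := by
    simp [Matrix.one_apply, hS, Matrix.trace]
  have hAv : A *ᵥ v = (1 / 2 : ℝ) • w := by
    rw [hwA, smul_smul]
    norm_num
  have hvAw : v ⬝ᵥ A *ᵥ w = (1 / 2) * (w ⬝ᵥ w) := by
    rw [Matrix.dotProduct_mulVec, ← Matrix.mulVec_transpose, hA.eq, hAv, smul_dotProduct,
      smul_eq_mul]
  have hvv : ∑ i, v i * v i = v ⬝ᵥ v := rfl
  have hww : ∑ i, w i * w i = w ⬝ᵥ w := rfl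
  have hvw : ∑ i, v i * w i = v ⬝ᵥ w := rfl
  simp only [sq, hQ', hM, hN', sum_antisymm_mul_antisymm, hone, htrace, htrace',
    Matrix.one_mulVec, Matrix.mulVec_neg, hAv, hvv, hww, hvw, smul_dotProduct, dotProduct_smul,
    neg_dotProduct, dotProduct_neg, smul_eq_mul, dotProduct_comm w v, hvAw]
  refine ⟨?_, ?_, ?_, ?_, ?_, ?_⟩ <;> ring
end

section
/- Assume n = 4. For a bivector α = ∑_{a<b} c_{ab} e_a∧e_b and k ∈ {1,2,3,4}, set P(α, e_k) = ∑_{a<b} c_{ab} P_{abk} and Q(α, e_k) = ∑_{a<b} c_{ab} Q_{abk}. Then ∑_{i=1}^{3} ∑_{k=1}^{4} P(α_i, e_k)·Q(α_i, e_k) = −(1/4)|w|², i.e. ⟨P⁺, Q⁺⟩ = −(1/4)|∇S|². -/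
/-- In dimension `n = 4`, with `P_{ijk} = (B_i)_{jk} − (B_j)_{ik}` and
`Q_{ijk} = δ_{ki}w_j − δ_{kj}w_i` as in the framework, and with
`P(α, e_k) = ∑_{a<b} c_{ab} P_{abk}` for a bivector `α = ∑_{a<b} c_{ab} e_a∧e_b`
(similarly for `Q`), one has, for the standard self-dual basis
`α₁ = (e₁∧e₂ + e₃∧e₄)/√2`, `α₂ = (e₁∧e₃ − e₂∧e₄)/√2`, `α₃ = (e₁∧e₄ + e₂∧e₃)/√2`:
`∑_{i=1}^{3} ∑_{k=1}^{4} P(α_i, e_k)·Q(α_i, e_k) = −(1/4)|w|²`,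
i.e. `⟨P⁺, Q⁺⟩ = −(1/4)|∇S|²`. -/
theorem selfDual_P_Q_pairing
    (w : Fin 4 → ℝ)
    (B : Fin 4 → Matrix (Fin 4) (Fin 4) ℝ)
    (hBsymm : ∀ i, (B i).IsSymm)
    (hBianchi : ∀ j, ∑ k, B k k j = (1 / 2) * w j)
    (htr : ∀ i, ∑ k, B i k k = w i)
    (P Q : Fin 4 → Fin 4 → Fin 4 → ℝ)
    (hP : ∀ i j k, P i j k = B i j k - B j i k)
    (hQ : ∀ i j k, Q i j k =
      (if k = i then (1 : ℝ) else 0) * w j - (if k = j then (1 : ℝ) else 0) * w i) :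
    (∑ k : Fin 4,
        (((P 0 1 k + P 2 3 k) / Real.sqrt 2) * ((Q 0 1 k + Q 2 3 k) / Real.sqrt 2)
          + ((P 0 2 k - P 1 3 k) / Real.sqrt 2) * ((Q 0 2 k - Q 1 3 k) / Real.sqrt 2)
          + ((P 0 3 k + P 1 2 k) / Real.sqrt 2) * ((Q 0 3 k + Q 1 2 k) / Real.sqrt 2)))
      = -(1 / 4) * ∑ i, (w i) ^ 2 := by
  have sqrt_two_mul_div (a b : ℝ) : a / Real.sqrt 2 * (b / Real.sqrt 2) = a * b / 2 := by
    rw [div_mul_div_comm, Real.mul_self_sqrt (by norm_num)]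
  have hB : ∀ i j k, B i j k = B i k j := fun i j k => (hBsymm i).apply k j
  simp only [Fin.sum_univ_four] at hBianchi htr
  simp only [sqrt_two_mul_div, Fin.sum_univ_four, hP, hQ]
  have h0 := hBianchi 0
  have h1 := hBianchi 1
  have h2 := hBianchi 2
  have h3 := hBianchi 3
  simp only [hB _ 1 0, hB _ 2 0, hB _ 3 0, hB _ 2 1, hB _ 3 1, hB _ 3 2] at h0 h1 h2 h3 ⊢
  norm_num [Fin.ext_iff]
  linear_combination (1 / 2) * (w 0 * (h0 - htr 0) + w 1 * (h1 - htr 1)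
    + w 2 * (h2 - htr 2) + w 3 * (h3 - htr 3))
end

section
/- Let W be an algebraic Weyl tensor on ℝ⁴, let κ ∈ ℝ, and define R̄_{ijkl} = W_{ijkl} + κ(δ_{ik}δ_{jl} − δ_{il}δ_{jk}). Then there exists an orthonormal basis e₁, e₂, e₃, e₄ of ℝ⁴ such that, writing the components of R̄ in this basis: (i) R̄_{ijkl} = 0 whenever exactly three of the indices i,j,k,l are distinct; (ii) R̄₁₂₁₂ = R̄₃₄₃₄ =: a₁, R̄₁₃₁₃ = R̄₂₄₂₄ =: a₂, R̄₁₄₁₄ = R̄₂₃₂₃ =: a₃, with a₁ ≤ a₂ ≤ a₃; (iii) a₁ is the minimum and a₃ is the maximum of R̄(X,Y,X,Y) over all orthonormal pairs X, Y ∈ ℝ⁴; (iv) setting b₁ = R̄₁₂₃₄, b₂ = R̄₁₃₄₂, b₃ = R̄₁₄₂₃, one has |b_i − b_j| ≤ |a_i − a_j| for all i, j ∈ {1,2,3}. -/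
noncomputable section

/-- Components of a 4-tensor `R` on `ℝ⁴` in the (orthonormal) basis `e`. -/
def comps (R : Fin 4 → Fin 4 → Fin 4 → Fin 4 → ℝ) (e : Fin 4 → Fin 4 → ℝ)
    (i j k l : Fin 4) : ℝ :=
  ∑ a, ∑ b, ∑ c, ∑ d, R a b c d * e i a * e j b * e k c * e l d

/-- The "sectional curvature" `R(X,Y,X,Y)` of a 4-tensor `R` on `ℝ⁴`. -/
def sec (R : Fin 4 → Fin 4 → Fin 4 → Fin 4 → ℝ) (X Y : Fin 4 → ℝ) : ℝ :=
  ∑ a, ∑ b, ∑ c, ∑ d, R a b c d * X a * Y b * X c * Y d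

/-- The value of the quadrilinear form with coefficients `R`. -/
def quadEval (R : Fin 4 → Fin 4 → Fin 4 → Fin 4 → ℝ) (X Y Z V : Fin 4 → ℝ) : ℝ :=
  ∑ a, ∑ b, ∑ c, ∑ d, R a b c d * X a * Y b * Z c * V d

section Multilinear

variable (R : Fin 4 → Fin 4 → Fin 4 → Fin 4 → ℝ) (e : Fin 4 → Fin 4 → ℝ) (x X Y Z V : Fin 4 → ℝ)

lemma quadEval_sum_slot₁ :
    quadEval R (fun a => ∑ i, x i * e i a) Y Z V = ∑ i, x i * quadEval R (e i) Y Z V := by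
  simp only [quadEval, Finset.mul_sum, Finset.sum_mul]
  symm
  iterate 4
    rw [Finset.sum_comm]
    refine Finset.sum_congr rfl fun _ _ => ?_
  exact Finset.sum_congr rfl fun _ _ => by ring

lemma quadEval_sum_slot₂ :
    quadEval R X (fun a => ∑ i, x i * e i a) Z V = ∑ i, x i * quadEval R X (e i) Z V := by
  simp only [quadEval, Finset.mul_sum, Finset.sum_mul]
  symm
  iterate 4
    rw [Finset.sum_comm]
    refine Finset.sum_congr rfl fun _ _ => ?_
  exact Finset.sum_congr rfl fun _ _ => by ring

lemma quadEval_sum_slot₃ :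
    quadEval R X Y (fun a => ∑ i, x i * e i a) V = ∑ i, x i * quadEval R X Y (e i) V := by
  simp only [quadEval, Finset.mul_sum, Finset.sum_mul]
  symm
  iterate 4
    rw [Finset.sum_comm]
    refine Finset.sum_congr rfl fun _ _ => ?_
  exact Finset.sum_congr rfl fun _ _ => by ring

lemma quadEval_sum_slot₄ :
    quadEval R X Y Z (fun a => ∑ i, x i * e i a) = ∑ i, x i * quadEval R X Y Z (e i) := by
  simp only [quadEval, Finset.mul_sum]
  symm
  iterate 4
    rw [Finset.sum_comm]
    refine Finset.sum_congr rfl fun _ _ => ?_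
  exact Finset.sum_congr rfl fun _ _ => by ring

/-- Sectional curvatures in terms of coordinates with respect to a frame. -/
lemma sec_comps (y : Fin 4 → ℝ) :
    sec (comps R e) x y = sec R (fun a => ∑ i, x i * e i a) (fun a => ∑ i, y i * e i a) := by
  change _ = quadEval R _ _ _ _
  rw [quadEval_sum_slot₁]
  simp only [quadEval_sum_slot₂]
  simp only [quadEval_sum_slot₃]
  simp only [quadEval_sum_slot₄, Finset.mul_sum]
  refine Finset.sum_congr rfl fun i _ => Finset.sum_congr rfl fun j _ =>
    Finset.sum_congr rfl fun k _ => Finset.sum_congr rfl fun l _ => ?_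
  change quadEval R (e i) (e j) (e k) (e l) * _ * _ * _ * _ = _
  ring

end Multilinear

/-- The symmetries of the curvature tensor of an Einstein metric with Einstein constant `E`,
except for the Bianchi identity. -/
structure IsEinsteinTensor (T : Fin 4 → Fin 4 → Fin 4 → Fin 4 → ℝ) (E : ℝ) : Prop where
  antisymm_left : ∀ i j k l, T i j k l = -T j i k l
  antisymm_right : ∀ i j k l, T i j k l = -T i j l k
  pair_symm : ∀ i j k l, T i j k l = T k l i j
  ricci : ∀ i j, ∑ k, T k i k j = if i = j then E else 0

/-- The rows of `e` form an orthonormal basis of `ℝ⁴`. -/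
def IsFrame (e : Fin 4 → Fin 4 → ℝ) : Prop :=
  ∀ i j, (∑ a, e i a * e j a) = if i = j then (1 : ℝ) else 0

lemma isFrame_iff (e : Fin 4 → Fin 4 → ℝ) :
    IsFrame e ↔ Matrix.of e * (Matrix.of e).transpose = 1 := by
  simp only [IsFrame, ← Matrix.ext_iff, Matrix.mul_apply, Matrix.transpose_apply, Matrix.of_apply,
    Matrix.one_apply]

lemma IsFrame.transpose {e : Fin 4 → Fin 4 → ℝ} (he : IsFrame e) :
    IsFrame (fun i j => e j i) := by
  rw [isFrame_iff] at he ⊢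
  exact mul_eq_one_comm.mp he

lemma IsFrame.comp {L e : Fin 4 → Fin 4 → ℝ} (hL : IsFrame L) (he : IsFrame e) :
    IsFrame (fun i a => ∑ j, L i j * e j a) := by
  rw [isFrame_iff] at *
  change (Matrix.of L * Matrix.of e) * (Matrix.of L * Matrix.of e).transpose = 1
  rw [Matrix.transpose_mul, Matrix.mul_assoc, ← Matrix.mul_assoc (Matrix.of e), he,
    Matrix.one_mul, hL]

lemma IsEinsteinTensor.comps {T : Fin 4 → Fin 4 → Fin 4 → Fin 4 → ℝ} {E : ℝ}
    (h : IsEinsteinTensor T E) {e : Fin 4 → Fin 4 → ℝ} (he : IsFrame e) :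
    IsEinsteinTensor (comps T e) E where
  antisymm_left i j k l := by
    simp only [_root_.comps]
    rw [Finset.sum_comm]
    simp only [← Finset.sum_neg_distrib]
    refine Finset.sum_congr rfl fun a _ => Finset.sum_congr rfl fun b _ =>
      Finset.sum_congr rfl fun c _ => Finset.sum_congr rfl fun d _ => ?_
    rw [h.antisymm_left]; ring
  antisymm_right i j k l := by
    simp only [_root_.comps, ← Finset.sum_neg_distrib]
    refine Finset.sum_congr rfl fun a _ => Finset.sum_congr rfl fun b _ => ?_
    rw [Finset.sum_comm]
    refine Finset.sum_congr rfl fun c _ => Finset.sum_congr rfl fun d _ => ?_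
    rw [h.antisymm_right]; ring
  pair_symm i j k l := by
    have key (f : Fin 4 → Fin 4 → Fin 4 → Fin 4 → ℝ) :
        ∑ a, ∑ b, ∑ c, ∑ d, f a b c d = ∑ c, ∑ d, ∑ a, ∑ b, f a b c d := by
      calc _ = ∑ a, ∑ c, ∑ d, ∑ b, f a b c d :=
            Finset.sum_congr rfl fun a _ => by
              rw [Finset.sum_comm]
              exact Finset.sum_congr rfl fun c _ => Finset.sum_comm
        _ = _ := by
              rw [Finset.sum_comm]
              exact Finset.sum_congr rfl fun c _ => Finset.sum_comm
    simp only [_root_.comps]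
    rw [key]
    refine Finset.sum_congr rfl fun a _ => Finset.sum_congr rfl fun b _ =>
      Finset.sum_congr rfl fun c _ => Finset.sum_congr rfl fun d _ => ?_
    rw [h.pair_symm]; ring
  ricci i j := by
    have ht := he.transpose
    calc ∑ k, _root_.comps T e k i k j
        = ∑ b, ∑ d, e i b * e j d * ∑ a, ∑ c, T a b c d * ∑ k, e k a * e k c := by
          simp only [_root_.comps, Finset.mul_sum]
          calc _ = ∑ a, ∑ b, ∑ c, ∑ d, ∑ k, T a b c d * e k a * e i b * e k c * e j d := by
                iterate 3
                  rw [Finset.sum_comm]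
                  refine Finset.sum_congr rfl fun _ _ => ?_
                exact Finset.sum_comm
            _ = ∑ b, ∑ d, ∑ a, ∑ c, ∑ k, T a b c d * e k a * e i b * e k c * e j d := by
                rw [Finset.sum_comm]
                refine Finset.sum_congr rfl fun b _ => ?_
                rw [Finset.sum_comm (s := Finset.univ (α := Fin 4)) (t := Finset.univ (α := Fin 4))
                  (f := fun d a => ∑ c, ∑ k, T a b c d * e k a * e i b * e k c * e j d)]
                exact Finset.sum_congr rfl fun a _ => Finset.sum_comm
            _ = _ := by
                refine Finset.sum_congr rfl fun b _ => Finset.sum_congr rfl fun d _ =>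
                  Finset.sum_congr rfl fun a _ => Finset.sum_congr rfl fun c _ =>
                  Finset.sum_congr rfl fun k _ => ?_
                ring
      _ = ∑ b, ∑ d, e i b * e j d * ∑ a, T a b a d := by
          refine Finset.sum_congr rfl fun b _ => Finset.sum_congr rfl fun d _ => ?_
          congr 1
          refine Finset.sum_congr rfl fun a _ => ?_
          simp [ht a]
      _ = if i = j then E else 0 := by
          simp only [h.ricci, mul_ite, mul_zero, Finset.sum_ite_eq, Finset.mem_univ, if_true]
          rw [← Finset.sum_mul, he i j]
          simp

lemma IsEinsteinTensor.eq_zero_left {T : Fin 4 → Fin 4 → Fin 4 → Fin 4 → ℝ} {E : ℝ}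
    (h : IsEinsteinTensor T E) (i k l : Fin 4) : T i i k l = 0 := by
  linarith [h.antisymm_left i i k l]

lemma IsEinsteinTensor.eq_zero_right {T : Fin 4 → Fin 4 → Fin 4 → Fin 4 → ℝ} {E : ℝ}
    (h : IsEinsteinTensor T E) (i j k : Fin 4) : T i j k k = 0 := by
  linarith [h.antisymm_right i j k k]

/-- The entries of a curvature operator satisfying the Einstein condition. -/
lemma IsEinsteinTensor.block_relations {T : Fin 4 → Fin 4 → Fin 4 → Fin 4 → ℝ} {E : ℝ}
    (h : IsEinsteinTensor T E) :
    T 2 3 2 3 = T 0 1 0 1 ∧ T 1 3 1 3 = T 0 2 0 2 ∧ T 1 2 1 2 = T 0 3 0 3 ∧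
    T 1 3 2 3 = -T 0 1 0 2 ∧ T 1 2 2 3 = T 0 1 0 3 ∧ T 1 2 1 3 = -T 0 2 0 3 ∧
    T 0 2 2 3 = -T 0 1 1 3 ∧ T 0 3 2 3 = T 0 1 1 2 ∧ T 0 3 1 3 = -T 0 2 1 2 := by
  have s1 := h.antisymm_left
  have s2 := h.antisymm_right
  have s3 := h.pair_symm
  have z1 := h.eq_zero_left
  have z2 := h.eq_zero_right
  have r := h.ricci
  simp only [Fin.sum_univ_four] at r
  have r00 := r 0 0
  have r11 := r 1 1
  have r22 := r 2 2
  have r33 := r 3 3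
  have r01 := r 0 1
  have r02 := r 0 2
  have r03 := r 0 3
  have r12 := r 1 2
  have r13 := r 1 3
  have r23 := r 2 3
  simp [z1, z2, s1 1 0, s1 2 0, s1 3 0, s1 2 1, s1 3 1, s1 3 2,
    s2 _ _ 1 0, s2 _ _ 2 0, s2 _ _ 3 0, s2 _ _ 2 1, s2 _ _ 3 1, s2 _ _ 3 2]
    at r00 r11 r22 r33 r01 r02 r03 r12 r13 r23
  have q1 := s3 1 3 2 3
  have q2 := s3 1 2 2 3
  have q3 := s3 1 2 1 3
  have q4 := s3 0 2 2 3
  have q5 := s3 0 3 2 3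
  have q6 := s3 0 3 1 3
  have q7 := s3 0 1 0 2
  have q8 := s3 0 1 0 3
  have q9 := s3 0 2 0 3
  have q10 := s3 0 1 1 3
  have q11 := s3 0 1 1 2
  have q12 := s3 0 2 1 2
  refine ⟨?_, ?_, ?_, ?_, ?_, ?_, ?_, ?_, ?_⟩ <;> linarith

/-- The quadratic form of one block of the curvature operator (self-dual for `t = 1`,
anti-self-dual for `t = -1`), evaluated on `X ∧ Y`. -/
def blockForm (T : Fin 4 → Fin 4 → Fin 4 → Fin 4 → ℝ) (t : ℝ) (x y : Fin 4 → ℝ) : ℝ :=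
  let u₁ := x 0 * y 1 - x 1 * y 0 + t * (x 2 * y 3 - x 3 * y 2)
  let u₂ := x 0 * y 2 - x 2 * y 0 - t * (x 1 * y 3 - x 3 * y 1)
  let u₃ := x 0 * y 3 - x 3 * y 0 + t * (x 1 * y 2 - x 2 * y 1)
  (T 0 1 0 1 + t * T 0 1 2 3) * u₁ ^ 2 + (T 0 2 0 2 - t * T 0 2 1 3) * u₂ ^ 2
    + (T 0 3 0 3 + t * T 0 3 1 2) * u₃ ^ 2
    + 2 * (T 0 1 0 2 - t * T 0 1 1 3) * (u₁ * u₂) + 2 * (T 0 1 0 3 + t * T 0 1 1 2) * (u₁ * u₃)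
    + 2 * (T 0 2 0 3 + t * T 0 2 1 2) * (u₂ * u₃)

lemma IsEinsteinTensor.sec_eq {T : Fin 4 → Fin 4 → Fin 4 → Fin 4 → ℝ} {E : ℝ}
    (h : IsEinsteinTensor T E) {t : ℝ} (ht : t = 1 ∨ t = -1) (x y : Fin 4 → ℝ) :
    sec T x y = (blockForm T t x y + blockForm T (-t) x y) / 2 := by
  have s1 := h.antisymm_left
  have s2 := h.antisymm_right
  have s3 := h.pair_symm
  obtain ⟨e1, e2, e3, e4, e5, e6, e7, e8, e9⟩ := h.block_relations
  rcases ht with rfl | rfl <;>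
  · simp only [sec, blockForm, Fin.sum_univ_four, h.eq_zero_left, h.eq_zero_right,
      s1 1 0, s1 2 0, s1 3 0, s1 2 1, s1 3 1, s1 3 2,
      s2 _ _ 1 0, s2 _ _ 2 0, s2 _ _ 3 0, s2 _ _ 2 1, s2 _ _ 3 1, s2 _ _ 3 2,
      s3 0 2 0 1, s3 0 3 0 1, s3 1 2 0 1, s3 1 3 0 1, s3 2 3 0 1,
      s3 0 3 0 2, s3 1 2 0 2, s3 1 3 0 2, s3 2 3 0 2, s3 1 2 0 3, s3 1 3 0 3, s3 2 3 0 3,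
      s3 1 3 1 2, s3 2 3 1 2, s3 2 3 1 3, e1, e2, e3, e4, e5, e6, e7, e8, e9]
    ring

/-- One-sided quaternion multiplication by `a + bi + cj + dk`, from the left or from the right
according to the sign `t`. -/
def isoclinic (t a b c d : ℝ) : Fin 4 → Fin 4 → ℝ :=
  ![![a, b, c, d], ![-b, a, t * d, -(t * c)], ![-c, -(t * d), a, t * b], ![-d, t * c, -(t * b), a]]

lemma isFrame_isoclinic {t a b c d : ℝ} (ht : t = 1 ∨ t = -1)
    (h : a ^ 2 + b ^ 2 + c ^ 2 + d ^ 2 = 1) : IsFrame (isoclinic t a b c d) := by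
  intro i j
  rcases ht with rfl | rfl <;> fin_cases i <;> fin_cases j <;>
    simp [isoclinic, Fin.sum_univ_four] <;> first | linear_combination h | ring1

/-- A quadratic condition on double angles that forces a critical point. -/
lemma nonneg_and_eq_zero_of_rotation {p m : ℝ}
    (h : ∀ c s : ℝ, c ^ 2 + s ^ 2 = 1 →
      0 ≤ p * (2 * c * s) ^ 2 + 2 * m * ((2 * c * s) * (c ^ 2 - s ^ 2))) : 0 ≤ p ∧ m = 0 := by
  have hom (C S : ℝ) : 0 ≤ p * S ^ 2 + 2 * m * (S * C) := by
    have := h (Real.cos (Complex.arg ⟨C, S⟩ / 2)) (Real.sin (Complex.arg ⟨C, S⟩ / 2))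
      (Real.cos_sq_add_sin_sq _)
    rw [← Real.cos_two_mul', show ∀ θ, 2 * Real.cos θ * Real.sin θ = Real.sin (2 * θ) from
      fun θ => by rw [Real.sin_two_mul]; ring, mul_div_cancel₀ _ two_ne_zero] at this
    have hC := Complex.norm_mul_cos_arg ⟨C, S⟩
    have hS := Complex.norm_mul_sin_arg ⟨C, S⟩
    simp only at hC hS
    generalize ‖(⟨C, S⟩ : ℂ)‖ = r at hC hS
    generalize Complex.arg ⟨C, S⟩ = θ at hC hS this
    rw [← hC, ← hS]
    linear_combination mul_nonneg (sq_nonneg r) this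
  have hp : 0 ≤ p := by simpa using hom 0 1
  refine ⟨hp, ?_⟩
  have := hom (p + 1) (-m)
  have h2 : m ^ 2 = 0 := by nlinarith [sq_nonneg m, mul_nonneg hp (sq_nonneg m)]
  exact pow_eq_zero_iff two_ne_zero |>.mp h2

lemma IsEinsteinTensor.block_of_forall_frame {T : Fin 4 → Fin 4 → Fin 4 → Fin 4 → ℝ} {E : ℝ}
    (h : IsEinsteinTensor T E)
    (hmax : ∀ L, IsFrame L → sec T (L 0) (L 3) - sec T (L 0) (L 1) ≤ T 0 3 0 3 - T 0 1 0 1)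
    {t : ℝ} (ht : t = 1 ∨ t = -1) :
    T 0 1 0 1 + t * T 0 1 2 3 ≤ T 0 2 0 2 - t * T 0 2 1 3 ∧
    T 0 2 0 2 - t * T 0 2 1 3 ≤ T 0 3 0 3 + t * T 0 3 1 2 ∧
    T 0 1 0 2 - t * T 0 1 1 3 = 0 ∧ T 0 1 0 3 + t * T 0 1 1 2 = 0 ∧
    T 0 2 0 3 + t * T 0 2 1 2 = 0 := by
  have hrot (a b c d : ℝ) (hq : a ^ 2 + b ^ 2 + c ^ 2 + d ^ 2 = 1) :=
    hmax _ (isFrame_isoclinic ht hq)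
  simp only [h.sec_eq ht, blockForm, isoclinic, Matrix.cons_val] at hrot
  have h23 := nonneg_and_eq_zero_of_rotation
    (p := T 0 3 0 3 + t * T 0 3 1 2 - (T 0 2 0 2 - t * T 0 2 1 3))
    (m := t * (T 0 2 0 3 + t * T 0 2 1 2)) fun c s hcs => by
      have := hrot c s 0 0 (by linear_combination hcs)
      rcases ht with rfl | rfl <;>
        linear_combination 2 * this - 2 * (T 0 3 0 3 - T 0 1 0 1) * (c ^ 2 + s ^ 2 + 1) * hcs
  have h13 := nonneg_and_eq_zero_of_rotation
    (p := 2 * (T 0 3 0 3 + t * T 0 3 1 2 - (T 0 1 0 1 + t * T 0 1 2 3)))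
    (m := -2 * t * (T 0 1 0 3 + t * T 0 1 1 2)) fun c s hcs => by
      have := hrot c 0 s 0 (by linear_combination hcs)
      rcases ht with rfl | rfl <;>
        linear_combination 2 * this - 2 * (T 0 3 0 3 - T 0 1 0 1) * (c ^ 2 + s ^ 2 + 1) * hcs
  have h12 := nonneg_and_eq_zero_of_rotation
    (p := T 0 2 0 2 - t * T 0 2 1 3 - (T 0 1 0 1 + t * T 0 1 2 3))
    (m := t * (T 0 1 0 2 - t * T 0 1 1 3)) fun c s hcs => by
      have := hrot c 0 0 s (by linear_combination hcs)
      rcases ht with rfl | rfl <;>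
        linear_combination 2 * this - 2 * (T 0 3 0 3 - T 0 1 0 1) * (c ^ 2 + s ^ 2 + 1) * hcs
  have ht0 : t ≠ 0 := by rcases ht with rfl | rfl <;> norm_num
  refine ⟨by linarith [h12.1], by linarith [h23.1], ?_, ?_, ?_⟩
  · simpa [ht0] using h12.2
  · simpa [ht0] using h13.2
  · simpa [ht0] using h23.2

lemma comps_eq_sec (R : Fin 4 → Fin 4 → Fin 4 → Fin 4 → ℝ) (e : Fin 4 → Fin 4 → ℝ)
    (i j : Fin 4) : comps R e i j i j = sec R (e i) (e j) := rfl

lemma blockForm_bounds {T : Fin 4 → Fin 4 → Fin 4 → Fin 4 → ℝ} {t : ℝ} (ht : t = 1 ∨ t = -1)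
    (h₁ : T 0 1 0 1 + t * T 0 1 2 3 ≤ T 0 2 0 2 - t * T 0 2 1 3)
    (h₂ : T 0 2 0 2 - t * T 0 2 1 3 ≤ T 0 3 0 3 + t * T 0 3 1 2)
    (h₃ : T 0 1 0 2 - t * T 0 1 1 3 = 0) (h₄ : T 0 1 0 3 + t * T 0 1 1 2 = 0)
    (h₅ : T 0 2 0 3 + t * T 0 2 1 2 = 0) {x y : Fin 4 → ℝ}
    (hx : ∑ a, x a * x a = 1) (hy : ∑ a, y a * y a = 1) (hxy : ∑ a, x a * y a = 0) :
    T 0 1 0 1 + t * T 0 1 2 3 ≤ blockForm T t x y ∧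
      blockForm T t x y ≤ T 0 3 0 3 + t * T 0 3 1 2 := by
  have hu : (x 0 * y 1 - x 1 * y 0 + t * (x 2 * y 3 - x 3 * y 2)) ^ 2
      + (x 0 * y 2 - x 2 * y 0 - t * (x 1 * y 3 - x 3 * y 1)) ^ 2
      + (x 0 * y 3 - x 3 * y 0 + t * (x 1 * y 2 - x 2 * y 1)) ^ 2 = 1 := by
    simp only [Fin.sum_univ_four] at hx hy hxy
    rcases ht with rfl | rfl <;>
      linear_combination (y 0 * y 0 + y 1 * y 1 + y 2 * y 2 + y 3 * y 3) * hx + hy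
        - (x 0 * y 0 + x 1 * y 1 + x 2 * y 2 + x 3 * y 3) * hxy
  simp only [blockForm, h₃, h₄, h₅]
  generalize x 0 * y 1 - x 1 * y 0 + t * (x 2 * y 3 - x 3 * y 2) = u₁ at *
  generalize x 0 * y 2 - x 2 * y 0 - t * (x 1 * y 3 - x 3 * y 1) = u₂ at *
  generalize x 0 * y 3 - x 3 * y 0 + t * (x 1 * y 2 - x 2 * y 1) = u₃ at *
  generalize T 0 1 0 1 + t * T 0 1 2 3 = A₁ at *
  generalize T 0 2 0 2 - t * T 0 2 1 3 = A₂ at *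
  generalize T 0 3 0 3 + t * T 0 3 1 2 = A₃ at *
  constructor
  · linear_combination mul_le_mul_of_nonneg_right h₁ (sq_nonneg u₂)
      + mul_le_mul_of_nonneg_right (h₁.trans h₂) (sq_nonneg u₃) - A₁ * hu
  · linear_combination mul_le_mul_of_nonneg_right h₂ (sq_nonneg u₂)
      + mul_le_mul_of_nonneg_right (h₁.trans h₂) (sq_nonneg u₁) + A₃ * hu

lemma IsEinsteinTensor.comps_eq_zero_of_card_eq_three {T : Fin 4 → Fin 4 → Fin 4 → Fin 4 → ℝ}
    {E : ℝ} (h : IsEinsteinTensor T E)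
    (h₁ : T 0 1 0 2 = 0) (h₂ : T 0 1 0 3 = 0) (h₃ : T 0 2 0 3 = 0) (h₄ : T 0 1 1 3 = 0)
    (h₅ : T 0 1 1 2 = 0) (h₆ : T 0 2 1 2 = 0) (i j k l : Fin 4)
    (hc : ({i, j, k, l} : Finset (Fin 4)).card = 3) : T i j k l = 0 := by
  have s1 := h.antisymm_left
  have s2 := h.antisymm_right
  have s3 := h.pair_symm
  obtain ⟨-, -, -, e4, e5, e6, e7, e8, e9⟩ := h.block_relations
  have key : ∀ i j l : Fin 4, i ≠ j → i ≠ l → j ≠ l → T i j i l = 0 := by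
    have key' : ∀ i j l : Fin 4, i ≠ j → i ≠ l → j < l → T i j i l = 0 := by
      intro i j l hij hil hjl
      have hlist : ∀ i j l : Fin 4, i ≠ j → i ≠ l → j < l →
          (i, j, l) ∈ ([(0, 1, 2), (0, 1, 3), (0, 2, 3), (1, 0, 2), (1, 0, 3), (1, 2, 3),
            (2, 0, 1), (2, 0, 3), (2, 1, 3), (3, 0, 1), (3, 0, 2), (3, 1, 2)] :
              List (Fin 4 × Fin 4 × Fin 4)) := by decide
      have hmem := hlist i j l hij hil hjl
      simp only [List.mem_cons, Prod.mk.injEq, List.not_mem_nil, or_false] at hmem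
      rcases hmem with ⟨rfl, rfl, rfl⟩ | ⟨rfl, rfl, rfl⟩ | ⟨rfl, rfl, rfl⟩ | ⟨rfl, rfl, rfl⟩ |
        ⟨rfl, rfl, rfl⟩ | ⟨rfl, rfl, rfl⟩ | ⟨rfl, rfl, rfl⟩ | ⟨rfl, rfl, rfl⟩ |
        ⟨rfl, rfl, rfl⟩ | ⟨rfl, rfl, rfl⟩ | ⟨rfl, rfl, rfl⟩ | ⟨rfl, rfl, rfl⟩ <;>
      simp only [s1 1 0, s1 2 0, s1 3 0, s1 2 1, s1 3 1, s2 _ _ 2 1, s2 _ _ 3 1, s2 _ _ 3 2,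
        e4, e5, e6, e7, e8, e9, h₁, h₂, h₃, h₄, h₅, h₆, neg_zero]
    intro i j l hij hil hjl
    rcases lt_or_gt_of_ne hjl with hlt | hlt
    · exact key' i j l hij hil hlt
    · rw [s3]; exact key' i l j hil hij hlt
  have hcases : ∀ i j k l : Fin 4, ({i, j, k, l} : Finset (Fin 4)).card = 3 →
      i = j ∨ k = l ∨ (i ≠ j ∧ k ≠ l ∧ ((i = k ∧ j ≠ l) ∨ (i = l ∧ j ≠ k) ∨
        (j = k ∧ i ≠ l) ∨ (j = l ∧ i ≠ k))) := by decide
  rcases hcases i j k l hc with rfl | rfl | ⟨hij, hkl, ⟨rfl, h'⟩ | ⟨rfl, h'⟩ | ⟨rfl, h'⟩ | ⟨rfl, h'⟩⟩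
  · exact h.eq_zero_left _ _ _
  · exact h.eq_zero_right _ _ _
  · exact key _ _ _ hij hkl h'
  · rw [s2, key _ _ _ hij hkl.symm h', neg_zero]
  · rw [s1, key _ _ _ hij.symm hkl h', neg_zero]
  · rw [s1, s2, key _ _ _ hij.symm hkl.symm h', neg_zero, neg_zero]

lemma isCompact_setOf_isFrame : IsCompact {e | IsFrame e} := by
  refine Metric.isCompact_of_isClosed_isBounded ?_ ?_
  · simp only [IsFrame, Set.ofPred_forall]
    exact isClosed_iInter fun i => isClosed_iInter fun j =>
      isClosed_eq (by fun_prop) continuous_const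
  · refine (Metric.isBounded_closedBall (x := 0) (r := 1)).subset fun e he => ?_
    rw [mem_closedBall_zero_iff, pi_norm_le_iff_of_nonneg zero_le_one]
    intro i
    rw [pi_norm_le_iff_of_nonneg zero_le_one]
    intro a
    have h1 := he i i
    rw [if_pos rfl] at h1
    have h2 := Finset.single_le_sum (fun b _ => mul_self_nonneg (e i b)) (Finset.mem_univ a)
    rw [Real.norm_eq_abs, abs_le_one_iff_mul_self_le_one]
    linarith

lemma exists_frame_forall_le (R : Fin 4 → Fin 4 → Fin 4 → Fin 4 → ℝ) :
    ∃ e, IsFrame e ∧ ∀ f, IsFrame f →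
      sec R (f 0) (f 3) - sec R (f 0) (f 1) ≤ sec R (e 0) (e 3) - sec R (e 0) (e 1) := by
  have hne : {e | IsFrame e}.Nonempty :=
    ⟨isoclinic 1 1 0 0 0, isFrame_isoclinic (Or.inl rfl) (by norm_num)⟩
  obtain ⟨e, he, hmax⟩ := isCompact_setOf_isFrame.exists_isMaxOn hne
    (f := fun e => sec R (e 0) (e 3) - sec R (e 0) (e 1))
    (by unfold sec; fun_prop)
  exact ⟨e, he, fun f hf => hmax hf⟩

lemma IsFrame.sum_coord_mul {e : Fin 4 → Fin 4 → ℝ} (he : IsFrame e) (X Y : Fin 4 → ℝ) :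
    ∑ i, (∑ a, e i a * X a) * (∑ a, e i a * Y a) = ∑ a, X a * Y a := by
  have h := (isFrame_iff _).mp he.transpose
  change (Matrix.of e).transpose * Matrix.of e = 1 at h
  change (Matrix.of e).mulVec X ⬝ᵥ (Matrix.of e).mulVec Y = X ⬝ᵥ Y
  rw [Matrix.dotProduct_mulVec, Matrix.vecMul_mulVec, h, Matrix.vecMul_one]

lemma IsFrame.sum_coord_smul {e : Fin 4 → Fin 4 → ℝ} (he : IsFrame e) (X : Fin 4 → ℝ) :
    (fun b => ∑ i, (∑ a, e i a * X a) * e i b) = X := by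
  have h := (isFrame_iff _).mp he.transpose
  change (Matrix.of e).transpose * Matrix.of e = 1 at h
  change Matrix.vecMul ((Matrix.of e).mulVec X) (Matrix.of e) = X
  rw [Matrix.vecMul_mulVec, h, Matrix.vecMul_one]

lemma isEinsteinTensor_weyl_add {W : Fin 4 → Fin 4 → Fin 4 → Fin 4 → ℝ}
    (hsym1 : ∀ i j k l, W i j k l = -W j i k l)
    (hsym2 : ∀ i j k l, W i j k l = -W i j l k)
    (hsym3 : ∀ i j k l, W i j k l = W k l i j)
    (htrace : ∀ i j, ∑ k, W k i k j = 0) {κ : ℝ}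
    {R : Fin 4 → Fin 4 → Fin 4 → Fin 4 → ℝ}
    (hR : ∀ i j k l, R i j k l = W i j k l +
      κ * ((if i = k then (1 : ℝ) else 0) * (if j = l then (1 : ℝ) else 0)
        - (if i = l then (1 : ℝ) else 0) * (if j = k then (1 : ℝ) else 0))) :
    IsEinsteinTensor R (3 * κ) where
  antisymm_left i j k l := by rw [hR, hR, hsym1]; ring
  antisymm_right i j k l := by rw [hR, hR, hsym2]; ring
  pair_symm i j k l := by
    rw [hR, hR, hsym3]
    simp only [eq_comm (a := k), eq_comm (a := l)]
    ring
  ricci i j := by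
    simp only [hR, Finset.sum_add_distrib, htrace, ← Finset.mul_sum, Finset.sum_sub_distrib]
    by_cases hij : i = j
    · simp [hij]
      ring
    · simp [hij]

/-- **Berger normal form.** Let `W` be an algebraic Weyl tensor on `ℝ⁴`,
`κ ∈ ℝ`, and `R̄_{ijkl} = W_{ijkl} + κ(δ_{ik}δ_{jl} − δ_{il}δ_{jk})`.  Then there is an
orthonormal basis `e₁,…,e₄` of `ℝ⁴` such that, in this basis: (i) components of `R̄` with
exactly three distinct indices vanish; (ii) `R̄₁₂₁₂ = R̄₃₄₃₄ = a₁`, `R̄₁₃₁₃ = R̄₂₄₂₄ = a₂`,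
`R̄₁₄₁₄ = R̄₂₃₂₃ = a₃` with `a₁ ≤ a₂ ≤ a₃`; (iii) `a₁` is the minimum and `a₃` the maximum
of `R̄(X,Y,X,Y)` over orthonormal pairs `X, Y`; (iv) with `b₁ = R̄₁₂₃₄`, `b₂ = R̄₁₃₄₂`,
`b₃ = R̄₁₄₂₃`, one has `|b_i − b_j| ≤ |a_i − a_j|` for all `i, j`. -/
theorem berger_normal_form
    (W : Fin 4 → Fin 4 → Fin 4 → Fin 4 → ℝ)
    (hsym1 : ∀ i j k l, W i j k l = -W j i k l)
    (hsym2 : ∀ i j k l, W i j k l = -W i j l k)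
    (hsym3 : ∀ i j k l, W i j k l = W k l i j)
    (hbianchi : ∀ i j k l, W i j k l + W i k l j + W i l j k = 0)
    (htrace : ∀ i j, ∑ k, W k i k j = 0)
    (κ : ℝ)
    (R : Fin 4 → Fin 4 → Fin 4 → Fin 4 → ℝ)
    (hR : ∀ i j k l, R i j k l = W i j k l +
      κ * ((if i = k then (1 : ℝ) else 0) * (if j = l then (1 : ℝ) else 0)
        - (if i = l then (1 : ℝ) else 0) * (if j = k then (1 : ℝ) else 0))) :
    ∃ e : Fin 4 → Fin 4 → ℝ,
      (∀ i j, (∑ a, e i a * e j a) = if i = j then (1 : ℝ) else 0) ∧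
      (∀ i j k l : Fin 4, ({i, j, k, l} : Finset (Fin 4)).card = 3 →
        comps R e i j k l = 0) ∧
      ∃ a1 a2 a3 b1 b2 b3 : ℝ,
        comps R e 0 1 0 1 = a1 ∧ comps R e 2 3 2 3 = a1 ∧
        comps R e 0 2 0 2 = a2 ∧ comps R e 1 3 1 3 = a2 ∧
        comps R e 0 3 0 3 = a3 ∧ comps R e 1 2 1 2 = a3 ∧
        a1 ≤ a2 ∧ a2 ≤ a3 ∧
        sec R (e 0) (e 1) = a1 ∧ sec R (e 0) (e 3) = a3 ∧
        (∀ X Y : Fin 4 → ℝ, (∑ a, X a * X a) = 1 → (∑ a, Y a * Y a) = 1 →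
          (∑ a, X a * Y a) = 0 → a1 ≤ sec R X Y ∧ sec R X Y ≤ a3) ∧
        comps R e 0 1 2 3 = b1 ∧ comps R e 0 2 3 1 = b2 ∧ comps R e 0 3 1 2 = b3 ∧
        |b1 - b2| ≤ |a1 - a2| ∧ |b1 - b3| ≤ |a1 - a3| ∧ |b2 - b3| ≤ |a2 - a3| := by
  have hRE := isEinsteinTensor_weyl_add hsym1 hsym2 hsym3 htrace hR
  obtain ⟨e, he, hmax⟩ := exists_frame_forall_le R
  have h := hRE.comps he
  have hframe (L : Fin 4 → Fin 4 → ℝ) (hL : IsFrame L) :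
      sec (comps R e) (L 0) (L 3) - sec (comps R e) (L 0) (L 1) ≤
        comps R e 0 3 0 3 - comps R e 0 1 0 1 := by
    rw [sec_comps, sec_comps, comps_eq_sec R e 0 3, comps_eq_sec R e 0 1]
    exact hmax (fun i a => ∑ j, L i j * e j a) (hL.comp he)
  have hp := h.block_of_forall_frame hframe (Or.inl rfl)
  have hm := h.block_of_forall_frame hframe (Or.inr rfl)
  have hb (x y : Fin 4 → ℝ) (hx : ∑ a, x a * x a = 1) (hy : ∑ a, y a * y a = 1)
      (hxy : ∑ a, x a * y a = 0) :
      comps R e 0 1 0 1 ≤ sec (comps R e) x y ∧ sec (comps R e) x y ≤ comps R e 0 3 0 3 := by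
    have bp := blockForm_bounds (Or.inl rfl) hp.1 hp.2.1 hp.2.2.1 hp.2.2.2.1 hp.2.2.2.2 hx hy hxy
    have bm := blockForm_bounds (Or.inr rfl) hm.1 hm.2.1 hm.2.2.1 hm.2.2.2.1 hm.2.2.2.2 hx hy hxy
    rw [h.sec_eq (Or.inl rfl)]
    constructor <;> linarith [bp.1, bp.2, bm.1, bm.2]
  obtain ⟨p1, p2, p3, p4, p5⟩ := hp
  obtain ⟨m1, m2, m3, m4, m5⟩ := hm
  obtain ⟨e1, e2, e3, -⟩ := h.block_relations
  have h0231 : comps R e 0 2 3 1 = -comps R e 0 2 1 3 := h.antisymm_right 0 2 3 1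
  refine ⟨e, he, h.comps_eq_zero_of_card_eq_three (by linarith) (by linarith) (by linarith)
    (by linarith) (by linarith) (by linarith), _, _, _, _, _, _, rfl, e1, rfl, e2, rfl, e3,
    by linarith, by linarith, (comps_eq_sec R e 0 1).symm, (comps_eq_sec R e 0 3).symm,
    fun X Y hX hY hXY => ?_, rfl, rfl, rfl, ?_, ?_, ?_⟩
  · have := hb (fun i => ∑ a, e i a * X a) (fun i => ∑ a, e i a * Y a)
      (by rw [he.sum_coord_mul, hX]) (by rw [he.sum_coord_mul, hY]) (by rw [he.sum_coord_mul, hXY])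
    rwa [sec_comps, he.sum_coord_smul, he.sum_coord_smul] at this
  all_goals
    refine le_trans ?_ (neg_le_abs _)
    exact abs_le.mpr ⟨by linarith, by linarith⟩
end
end
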